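/- arXiv:math/0611760 — 3 statements merged into one kernel-verified Lean document; each statement's English description precedes it below -/
import Mathlib

section
/- Let R be a commutative ring, f = (f_1, …, f_r) a sequence in R, and E an R-complex such that H^j(E) is fR-torsion for all j ≥ −r. Let b ≥ 0 and let P be a complex of finitely generated projective R-modules vanishing in all degrees outside [0, b], and let λ : P → E be a morphism in D(R). Then there exist an integer n > 0 and a homomorphism of R-complexes λ_n : K_•(f_1^n, …, f_r^n) ⊗_R P → E such that for all j ≥ −r, the homology map H^j(λ) : H^j(P) → H^j(E) factors as H^j(P) = H^j(R ⊗_R P) → H^j(K_•(f_1^n, …, f_r^n) ⊗_R P) → H^j(E), where the first map is induced by the canonical map R → K_•(f_1^n, …, f_r^n) and the second map is H^j(λ_n). -/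
/-!
Koszul complexes (cohomologically indexed, over the category of `R`-modules).
For `f ∈ R` and a complex `E`, the tensor product `K_•(f) ⊗_R E` is (naturally isomorphic
to) the mapping cone of multiplication by `f` on `E`; accordingly the tensor product
`K_•(f₁, …, f_r) ⊗_R P` is defined as an iterated mapping cone, and the Koszul complex
`K_•(f₁, …, f_r)` is the case `P = R` (the ring placed in degree `0`).
-/

open CategoryTheory

universe u

noncomputable section

variable (R : Type u) [CommRing R]

/-- The complex consisting of `R` placed in degree `0`. -/
def singleR : CochainComplex (ModuleCat.{u} R) ℤ :=
  (HomologicalComplex.single (ModuleCat.{u} R) (ComplexShape.up ℤ) 0).obj (ModuleCat.of R R)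

/-- `koszulTensor R l P` is the tensor product `K_•(l) ⊗_R P` of the Koszul complex on the
list `l` with the complex `P`, defined as the iterated mapping cone of multiplication by
the elements of `l` on `P`. -/
def koszulTensor : List R → CochainComplex (ModuleCat.{u} R) ℤ →
    CochainComplex (ModuleCat.{u} R) ℤ
  | [], P => P
  | f :: fs, P => CochainComplex.mappingCone ((f • 𝟙 (koszulTensor fs P)))

/-- The Koszul complex `K_•(l)` on a list `l` of elements of `R`. -/
def koszul (l : List R) : CochainComplex (ModuleCat.{u} R) ℤ := koszulTensor R l (singleR R)

/-- The canonical map `P = R ⊗_R P ⟶ K_•(l) ⊗_R P` induced by the map of complexes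
`R → K_•(l)` which is the identity in degree `0`. -/
def koszulTensorUnit : (l : List R) → (P : CochainComplex (ModuleCat.{u} R) ℤ) →
    (P ⟶ koszulTensor R l P)
  | [], P => 𝟙 P
  | f :: fs, P =>
      koszulTensorUnit fs P ≫ CochainComplex.mappingCone.inr (f • 𝟙 (koszulTensor R fs P))

/-- A module `M` is `I`-torsion if every element of `M` is annihilated by some power of
the ideal `I`. -/
def IsIdealTorsion (I : Ideal R) (M : Type u) [AddCommGroup M] [Module R M] : Prop :=
  ∀ x : M, ∃ k : ℕ, ∀ a ∈ I ^ k, a • x = 0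

end

noncomputable section KoszulExtension

open CochainComplex HomComplex Limits

variable {R : Type u} [CommRing R]

/-- If every element of `H^k(E)` is killed by a power of `a`, then every map from a finite
projective module to the cocycles of `E` of degree `k` becomes a coboundary after
multiplication by a power of `a`. -/
lemma exists_pow_smul_eq_comp_d (a : R) (E : CochainComplex (ModuleCat.{u} R) ℤ) (k : ℤ)
    (hE : ∀ x : E.homology k, ∃ n : ℕ, a ^ n • x = 0)
    (M : ModuleCat.{u} R) [Module.Finite R M] [Projective M]
    (g : M ⟶ E.X k) (hg : g ≫ E.d k (k + 1) = 0) :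
    ∃ (n : ℕ) (h : M ⟶ E.X (k - 1)), a ^ n • g = h ≫ E.d (k - 1) k := by
  have hnext : (ComplexShape.up ℤ).next k = k + 1 := by simp
  have hprev : (ComplexShape.up ℤ).prev k = k - 1 := by simp
  let p := E.liftCycles g (k + 1) hnext hg ≫ E.homologyπ k
  obtain ⟨n, hn⟩ : ∃ n : ℕ, a ^ n • p = 0 := by
    obtain ⟨s, hs⟩ := Module.Finite.fg_top (R := R) (M := M)
    choose e he using fun x : M => hE (p x)
    refine ⟨s.sup e, ?_⟩
    ext : 1
    refine LinearMap.ext_on hs fun x hx => ?_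
    obtain ⟨c, hc⟩ := pow_dvd_pow a (Finset.le_sup (f := e) hx)
    change a ^ s.sup e • p x = 0
    rw [hc, mul_comm, mul_smul, he, smul_zero]
  have hg' : (a ^ n • g) ≫ E.d k (k + 1) = 0 := by simp [hg]
  have hlift : E.liftCycles (a ^ n • g) (k + 1) hnext hg' ≫ E.homologyπ k = 0 := by
    rw [← hn, ← Linear.smul_comp]
    congr 1
    simp [← cancel_mono (E.iCycles k)]
  obtain ⟨A, π, _, x, hx⟩ :=
    (E.liftCycles_comp_homologyπ_eq_zero_iff_up_to_refinements _ _ _ hprev hnext _ hg').1 hlift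
  refine ⟨n, Projective.factorThru (𝟙 M) π ≫ x, ?_⟩
  rw [Category.assoc, ← hx, Projective.factorThru_comp_assoc, Category.id_comp]

/-- Multiplication by a high power of `a` annihilates, up to homotopy, every map from a bounded
complex of finite projective modules to a complex whose cohomology is `a`-power torsion in the
relevant degrees. -/
lemma exists_homotopy_pow_smul_zero (a : R) (E X : CochainComplex (ModuleCat.{u} R) ℤ) (c : ℤ)
    (hE : ∀ j : ℤ, c ≤ j → ∀ x : E.homology j, ∃ n : ℕ, a ^ n • x = 0)
    (hfin : ∀ i, Module.Finite R (X.X i)) (hproj : ∀ i, Projective (X.X i))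
    (hc : ∀ i < c, IsZero (X.X i)) (m : ℕ) (φ : X ⟶ E) (hφ : ∀ i, c + m ≤ i → φ.f i = 0) :
    ∃ n : ℕ, Nonempty (Homotopy (a ^ n • φ) 0) := by
  induction m generalizing φ with
  | zero =>
    have : φ = 0 := by
      ext1 i
      rcases lt_or_ge i c with h | h
      · exact (hc i h).eq_of_src _ _
      · exact hφ i (by simpa using h)
    exact ⟨0, ⟨Homotopy.ofEq (by simp [this])⟩⟩
  | succ m ih =>
    set k : ℤ := c + m with hk
    have hφk : φ.f k ≫ E.d k (k + 1) = 0 := by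
      rw [φ.comm, hφ (k + 1) (by push_cast; lia), comp_zero]
    obtain ⟨n₁, h, hh⟩ := exists_pow_smul_eq_comp_d a E k (hE k (by lia)) (X.X k) (φ.f k) hφk
    let s : ∀ i j, (ComplexShape.up ℤ).Rel j i → (X.X i ⟶ E.X j) :=
      fun i j hij => (Cochain.single h (-1)).v i j (by have : j + 1 = i := hij; lia)
    let ψ := a ^ n₁ • φ - Homotopy.nullHomotopicMap' s
    obtain ⟨n₂, ⟨H⟩⟩ := ih ψ (by
      intro i hi
      have h₁ : (ComplexShape.up ℤ).Rel (i - 1) i := by simp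
      have h₂ : (ComplexShape.up ℤ).Rel i (i + 1) := by simp
      simp only [ψ, HomologicalComplex.sub_f_apply, HomologicalComplex.smul_f_apply,
        Homotopy.nullHomotopicMap'_f h₁ h₂, s]
      rw [Cochain.single_v_eq_zero _ _ _ _ _ (by lia), comp_zero, zero_add]
      obtain rfl | hik := eq_or_ne i k
      · rw [Cochain.single_v, hh, sub_self]
      · rw [Cochain.single_v_eq_zero _ _ _ _ _ hik, hφ i (by push_cast; lia)]
        simp)
    have hsum : a ^ (n₂ + n₁) • φ = a ^ n₂ • ψ + Homotopy.nullHomotopicMap' s ≫ (a ^ n₂ • 𝟙 E) := by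
      simp [ψ, smul_sub, pow_add, mul_smul]
    exact ⟨n₂ + n₁, ⟨(Homotopy.ofEq hsum).trans
      ((H.add ((Homotopy.nullHomotopy' s).compRight _)).trans (Homotopy.ofEq (by simp)))⟩⟩

lemma isZero_koszulTensor_X (l : List R) (P : CochainComplex (ModuleCat.{u} R) ℤ) (b : ℤ)
    (hP : ∀ i : ℤ, (i < 0 ∨ b < i) → IsZero (P.X i)) (i : ℤ)
    (hi : i < -(l.length : ℤ) ∨ b < i) : IsZero ((koszulTensor R l P).X i) := by
  induction l generalizing i with
  | nil => exact hP i (by simpa using hi)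
  | cons a l ih =>
    simp only [List.length_cons, Nat.cast_add, Nat.cast_one] at hi
    exact (mappingCone.isZero_X_iff _ i).2 ⟨ih _ (by lia), ih _ (by lia)⟩

/-- The terms of a mapping cone of complexes of modules. -/
def mappingConeXIsoProd {F G : CochainComplex (ModuleCat.{u} R) ℤ} (φ : F ⟶ G) (i : ℤ) :
    (mappingCone φ).X i ≅ ModuleCat.of R (F.X (i + 1) × G.X i) :=
  HomologicalComplex.homotopyCofiber.XIsoBiprod φ i (i + 1) rfl ≪≫ ModuleCat.biprodIsoProd _ _

lemma finite_and_projective_koszulTensor_X (l : List R) (P : CochainComplex (ModuleCat.{u} R) ℤ)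
    (hP : ∀ i : ℤ, Module.Finite R (P.X i) ∧ Module.Projective R (P.X i)) (i : ℤ) :
    Module.Finite R ((koszulTensor R l P).X i) ∧
      Module.Projective R ((koszulTensor R l P).X i) := by
  induction l generalizing i with
  | nil => exact hP i
  | cons a l ih =>
    obtain ⟨_, _⟩ := ih i
    obtain ⟨_, _⟩ := ih (i + 1)
    have e := (mappingConeXIsoProd (a • 𝟙 (koszulTensor R l P)) i).toLinearEquiv.symm
    exact ⟨Module.Finite.equiv e, Module.Projective.of_equiv e⟩

/-- If `n ≤ m`, the canonical map `P ⟶ K_•(lⁿ) ⊗ P` factors through `P ⟶ K_•(lᵐ) ⊗ P`. -/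
lemma exists_koszulTensorUnit_pow_comp_eq (l : List R) (P : CochainComplex (ModuleCat.{u} R) ℤ)
    {n m : ℕ} (h : n ≤ m) :
    ∃ g : koszulTensor R (l.map (· ^ m)) P ⟶ koszulTensor R (l.map (· ^ n)) P,
      koszulTensorUnit R (l.map (· ^ m)) P ≫ g = koszulTensorUnit R (l.map (· ^ n)) P := by
  induction l with
  | nil => exact ⟨𝟙 P, Category.comp_id _⟩
  | cons a l ih =>
    obtain ⟨g, hg⟩ := ih
    obtain ⟨c, hc⟩ := pow_dvd_pow a h
    refine ⟨mappingCone.map (a ^ m • 𝟙 _) (a ^ n • 𝟙 _) (c • g) g ?_, ?_⟩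
    · simp [hc, mul_smul]
    · change (koszulTensorUnit R (l.map (· ^ m)) P ≫ mappingCone.inr (a ^ m • 𝟙 _)) ≫ _ =
        koszulTensorUnit R (l.map (· ^ n)) P ≫ mappingCone.inr (a ^ n • 𝟙 _)
      simp [mappingCone.map, reassoc_of% hg]

/-- A map from a bounded complex `P` of finite projective modules to a complex with torsion
cohomology extends to `K_•(lⁿ) ⊗ P` for some `n > 0`. -/
lemma exists_koszulTensorUnit_comp_eq (l : List R) (E P : CochainComplex (ModuleCat.{u} R) ℤ)
    (hE : ∀ a ∈ l, ∀ j : ℤ, -(l.length : ℤ) ≤ j →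
      ∀ x : E.homology j, ∃ n : ℕ, a ^ n • x = 0)
    (b : ℤ) (hPfgproj : ∀ i : ℤ, Module.Finite R (P.X i) ∧ Module.Projective R (P.X i))
    (hPbdd : ∀ i : ℤ, (i < 0 ∨ b < i) → IsZero (P.X i)) (φ : P ⟶ E) :
    ∃ n : ℕ, 0 < n ∧ ∃ ψ : koszulTensor R (l.map (· ^ n)) P ⟶ E,
      koszulTensorUnit R (l.map (· ^ n)) P ≫ ψ = φ := by
  induction l with
  | nil => exact ⟨1, one_pos, φ, Category.id_comp _⟩
  | cons a l ih =>
    simp only [List.length_cons, Nat.cast_add, Nat.cast_one] at hE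
    obtain ⟨n₀, hn₀, ψ₀, hψ₀⟩ := ih fun a' ha' j hj =>
      hE a' (List.mem_cons_of_mem _ ha') j (by lia)
    have hX := finite_and_projective_koszulTensor_X (l.map (· ^ n₀)) P hPfgproj
    have hX0 := isZero_koszulTensor_X (l.map (· ^ n₀)) P b hPbdd
    rw [List.length_map] at hX0
    obtain ⟨k, ⟨H⟩⟩ := exists_homotopy_pow_smul_zero a E (koszulTensor R (l.map (· ^ n₀)) P)
      (-(l.length : ℤ)) (fun j hj => hE a List.mem_cons_self j (by lia)) (fun i => (hX i).1)
      (fun i => (IsProjective.iff_projective _).1 (hX i).2) (fun i hi => hX0 i (.inl hi))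
      (b + 1 + l.length).toNat ψ₀ (fun i hi => (hX0 i (.inr (by lia))).eq_of_src _ _)
    obtain ⟨n, hn, hk⟩ : ∃ n, n₀ ≤ n ∧ k ≤ n := ⟨max n₀ k, le_max_left _ _, le_max_right _ _⟩
    obtain ⟨g, hg⟩ := exists_koszulTensorUnit_pow_comp_eq l P hn
    obtain ⟨c, hc⟩ := pow_dvd_pow a hk
    have H' : Homotopy ((a ^ n • 𝟙 (koszulTensor R (l.map (· ^ n)) P)) ≫ g ≫ ψ₀) 0 :=
      (Homotopy.ofEq (by simp [hc, mul_smul])).trans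
        ((H.compLeft (c • g)).trans (Homotopy.ofEq (by simp)))
    refine ⟨n, hn₀.trans_le hn,
      mappingCone.desc _ (Cochain.equivHomotopy _ _ H').1 (g ≫ ψ₀) ?_, ?_⟩
    · simp
    · change (koszulTensorUnit R (l.map (· ^ n)) P ≫ mappingCone.inr (a ^ n • 𝟙 _)) ≫ _ = _
      rw [Category.assoc, mappingCone.inr_desc, reassoc_of% hg, hψ₀]

lemma exists_Q_map_eq [HasDerivedCategory.{u + 1} (ModuleCat.{u} R)]
    (P E : CochainComplex (ModuleCat.{u} R) ℤ) [P.IsKProjective]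
    (lam : DerivedCategory.Q.obj P ⟶ DerivedCategory.Q.obj E) :
    ∃ φ : P ⟶ E, DerivedCategory.Q.map φ = lam := by
  obtain ⟨g, hg⟩ := (IsKProjective.Qh_map_bijective P
    ((HomotopyCategory.quotient _ _).obj E)).surjective lam
  obtain ⟨φ, rfl⟩ := (HomotopyCategory.quotient _ _).map_surjective g
  exact ⟨φ, hg⟩

end KoszulExtension

open DerivedCategory CategoryTheory.Limits in
/-- **Lemma 5.7 of Lipman–Neeman.** Let `f = (f₁, …, f_r)` be a sequence in a commutative
ring `R`, and `E` an `R`-complex with `H^j(E)` an `fR`-torsion module for all `j ≥ −r`.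
Let `b ≥ 0` and let `P` be a complex of finitely generated projective `R`-modules
vanishing in all degrees outside `[0, b]`, and `λ : P ⟶ E` a morphism in `D(R)`.
Then there are an integer `n > 0` and a map of complexes
`λₙ : K_•(f₁ⁿ, …, f_rⁿ) ⊗_R P ⟶ E` such that for all `j ≥ −r` the homology map
`H^j(λ)` factors as `H^j(P) = H^j(R ⊗ P) ⟶ H^j(K_•(f₁ⁿ, …, f_rⁿ) ⊗ P) ⟶ H^j(E)`,
the first map being induced by the canonical map `R ⟶ K_•(f₁ⁿ, …, f_rⁿ)` and the
second being `H^j(λₙ)`. -/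
theorem statement_15 (R : Type u) [CommRing R]
    [HasDerivedCategory.{u + 1} (ModuleCat.{u} R)]
    (r : ℕ) (f : Fin r → R)
    (E : CochainComplex (ModuleCat.{u} R) ℤ)
    (hE : ∀ j : ℤ, -(r : ℤ) ≤ j → IsIdealTorsion R (Ideal.span (Set.range f)) (E.homology j))
    (b : ℤ) (hb : 0 ≤ b)
    (P : CochainComplex (ModuleCat.{u} R) ℤ)
    (hPfgproj : ∀ i : ℤ, Module.Finite R (P.X i) ∧ Module.Projective R (P.X i))
    (hPbdd : ∀ i : ℤ, (i < 0 ∨ b < i) → IsZero (P.X i))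
    (lam : Q.obj P ⟶ Q.obj E) :
    ∃ n : ℕ, 0 < n ∧
      ∃ lamn : koszulTensor R (List.ofFn fun i => f i ^ n) P ⟶ E,
        ∀ j : ℤ, -(r : ℤ) ≤ j →
          (homologyFunctor (ModuleCat.{u} R) j).map lam =
            (homologyFunctor (ModuleCat.{u} R) j).map
              (Q.map (koszulTensorUnit R (List.ofFn fun i => f i ^ n) P)) ≫
            (homologyFunctor (ModuleCat.{u} R) j).map (Q.map lamn) := by
  have : ∀ i, Projective (P.X i) := fun i => (IsProjective.iff_projective _).1 (hPfgproj i).2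
  have : P.IsStrictlyLE b := (P.isStrictlyLE_iff b).2 fun i hi => hPbdd i (.inr hi)
  have : P.IsKProjective := CochainComplex.isKProjective_of_projective P b
  obtain ⟨φ, rfl⟩ := exists_Q_map_eq P E lam
  obtain ⟨n, hn, ψ, hψ⟩ := exists_koszulTensorUnit_comp_eq (List.ofFn f) E P (by
    intro a ha j hj x
    obtain ⟨k, hk⟩ := hE j (by simpa using hj) x
    exact ⟨k, hk _ (Ideal.pow_mem_pow
      (Ideal.subset_span (by simpa [List.mem_ofFn] using ha)) k)⟩) b hPfgproj hPbdd φ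
  have hl : (List.ofFn fun i => f i ^ n) = (List.ofFn f).map (· ^ n) := by
    rw [List.map_ofFn, Function.comp_def]
  refine ⟨n, hn, ?_⟩
  rw [hl]
  exact ⟨ψ, fun j _ => by rw [← Functor.map_comp, ← Functor.map_comp, hψ]⟩
end

section
/- Let R be a commutative ring, f = (f_1, …, f_r) a sequence in R, I = (f_1, …, f_r)R, and m an integer. Let E be an R-complex such that H^i(E) is I-torsion for all i ≥ m − r. If E is m-pseudo-coherent and p ≥ m is an integer with H^i(E) = 0 for all i > p, then there exists in the homotopy category K(R) an m-quasi-isomorphism P → E with P an object of {K_•(f_1, …, f_r)}[m, p]. -/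
/-!
Koszul complexes (cohomologically indexed, over the category of `R`-modules).
For `f ∈ R` and a complex `E`, the tensor product `K_•(f) ⊗_R E` is (naturally isomorphic
to) the mapping cone of multiplication by `f` on `E`; accordingly the tensor product
`K_•(f₁, …, f_r) ⊗_R P` is defined as an iterated mapping cone, and the Koszul complex
`K_•(f₁, …, f_r)` is the case `P = R` (the ring placed in degree `0`).
-/

open CategoryTheory

universe u

/-!
Common setup: for a triangulated category `T`, a class of objects `S` and integers
`m ≤ n`, `SmnMem S m n E` expresses that `E` belongs to `S[m,n]`, the smallest full
subcategory of `T` containing `0`, containing `E⟦-ℓ⟧` (that is, `E[-ℓ]`) for every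
`E ∈ S` and every integer `ℓ` with `m ≤ ℓ ≤ n`, and such that for every distinguished
triangle `E ⟶ F ⟶ G ⟶ E⟦1⟧`, if `E` and `G` lie in it then so does `F`.
(Membership in a full subcategory is determined by the class of objects.)
-/

open CategoryTheory CategoryTheory.Limits CategoryTheory.Pretriangulated

universe w v v₁ u₁

/-- Membership in the subcategory `S[m,n]` of Lipman–Neeman, Definition 5.1. -/
inductive SmnMem {T : Type u} [Category.{v} T] [HasZeroObject T] [Preadditive T]
    [HasShift T ℤ] [∀ n : ℤ, (shiftFunctor T n).Additive] [Pretriangulated T]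
    (S : Set T) (m n : ℤ) : T → Prop
  | zero (Z : T) (hZ : IsZero Z) : SmnMem S m n Z
  | shift (E : T) (hE : E ∈ S) (ℓ : ℤ) (h₁ : m ≤ ℓ) (h₂ : ℓ ≤ n) : SmnMem S m n (E⟦(-ℓ : ℤ)⟧)
  | ext (Tr : Triangle T) (hTr : Tr ∈ distTriang T)
      (h₁ : SmnMem S m n Tr.obj₁) (h₃ : SmnMem S m n Tr.obj₃) : SmnMem S m n Tr.obj₂

section Triangulated

open scoped ZeroObject

variable {T : Type u} [Category.{v} T] [HasZeroObject T] [Preadditive T]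
  [HasShift T ℤ] [∀ n : ℤ, (shiftFunctor T n).Additive] [Pretriangulated T]

lemma SmnMem.of_iso {S : Set T} {m n : ℤ} {X Y : T} (hX : SmnMem S m n X) (e : X ≅ Y) :
    SmnMem S m n Y := by
  obtain ⟨Z, g, h, hT⟩ := distinguished_cocone_triangle e.hom
  exact SmnMem.ext _ hT hX
    (.zero Z (Triangle.isZero₃_of_isIso₁ _ hT (inferInstanceAs (IsIso e.hom))))

lemma SmnMem.mono {S : Set T} {m n m' n' : ℤ} (hm : m' ≤ m) (hn : n ≤ n') {X : T}
    (hX : SmnMem S m n X) : SmnMem S m' n' X := by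
  induction hX with
  | zero Z hZ => exact .zero Z hZ
  | shift E hE ℓ h₁ h₂ => exact .shift E hE ℓ (hm.trans h₁) (h₂.trans hn)
  | ext Tr hTr _ _ ih₁ ih₃ => exact .ext Tr hTr ih₁ ih₃

/-- A morphism `g : X ⟶ Y` has a fiber satisfying `A` if it fits in a distinguished triangle
`P ⟶ X ⟶ Y ⟶ P⟦1⟧` with `A P`. -/
def HasFiberIn (A : T → Prop) {X Y : T} (g : X ⟶ Y) : Prop :=
  ∃ (P : T) (i : P ⟶ X) (h : Y ⟶ P⟦(1 : ℤ)⟧), A P ∧ Triangle.mk i g h ∈ distTriang T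

lemma HasFiberIn.mono {A B : T → Prop} (hAB : ∀ P, A P → B P) {X Y : T} {g : X ⟶ Y}
    (hg : HasFiberIn A g) : HasFiberIn B g := by
  obtain ⟨P, i, h, hP, hT⟩ := hg
  exact ⟨P, i, h, hAB P hP, hT⟩

lemma HasFiberIn.id {A : T → Prop} (hA : ∀ Z, IsZero Z → A Z) (X : T) :
    HasFiberIn A (𝟙 X) :=
  ⟨0, 0, 0, hA 0 (isZero_zero T), contractible_distinguished₁ X⟩

lemma HasFiberIn.comp [IsTriangulated T] {A B C : T → Prop}
    (hABC : ∀ Tr ∈ distTriang T, A Tr.obj₁ → B Tr.obj₃ → C Tr.obj₂)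
    {X Y Z : T} {g : X ⟶ Y} {g' : Y ⟶ Z} (hg : HasFiberIn A g) (hg' : HasFiberIn B g') :
    HasFiberIn C (g ≫ g') := by
  obtain ⟨P, i, h, hP, hT⟩ := hg
  obtain ⟨P', i', h', hP', hT'⟩ := hg'
  obtain ⟨P'', i'', h'', hT''⟩ := distinguished_cocone_triangle₁ (g ≫ g')
  let o := Triangulated.someOctahedron' rfl hT hT' hT''
  exact ⟨P'', i'', h'', hABC _ o.mem hP hP', hT''⟩

end Triangulated

section Nilpotent

variable {T : Type u} [Category.{v} T] [HasZeroObject T] [Preadditive T]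
  [HasShift T ℤ] [∀ n : ℤ, (shiftFunctor T n).Additive] [Pretriangulated T]
  {R : Type w} [CommRing R] [Linear R T]

lemma smul_id_eq_zero_of_distinguished {Tr : Triangle T} (hTr : Tr ∈ distTriang T) {a b : R}
    (ha : a • Tr.mor₁ = 0) (hb : b • Tr.mor₂ = 0) : (a * b) • 𝟙 Tr.obj₂ = 0 := by
  obtain ⟨χ, hχ⟩ := Triangle.coyoneda_exact₂ _ hTr (b • 𝟙 Tr.obj₂) (by simpa using hb)
  rw [mul_smul, hχ, ← Linear.comp_smul, ha, comp_zero]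

/-- A power of `f` annihilates the object `X`. -/
def IsPowTorsion (f : R) (X : T) : Prop := ∃ N : ℕ, f ^ N • 𝟙 X = 0

lemma IsPowTorsion.ext {f : R} {Tr : Triangle T} (hTr : Tr ∈ distTriang T)
    (h₁ : IsPowTorsion f Tr.obj₁) (h₃ : IsPowTorsion f Tr.obj₃) : IsPowTorsion f Tr.obj₂ := by
  obtain ⟨a, ha⟩ := h₁
  obtain ⟨b, hb⟩ := h₃
  refine ⟨a + b, ?_⟩
  rw [pow_add]
  refine smul_id_eq_zero_of_distinguished hTr ?_ ?_
  · rw [← Category.id_comp Tr.mor₁, ← Linear.smul_comp, ha, zero_comp]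
  · rw [← Category.comp_id Tr.mor₂, ← Linear.comp_smul, hb, comp_zero]

end Nilpotent

lemma IsPowTorsion.shift {T : Type u} [Category.{v} T] [Preadditive T] [HasShift T ℤ]
    [∀ n : ℤ, (shiftFunctor T n).Additive] {R : Type w} [CommRing R] [Linear R T]
    [∀ n : ℤ, (shiftFunctor T n).Linear R] {f : R} {X : T}
    (h : IsPowTorsion f X) (n : ℤ) : IsPowTorsion f (X⟦n⟧) := by
  obtain ⟨a, ha⟩ := h
  refine ⟨a, ?_⟩
  rw [← CategoryTheory.Functor.map_id, ← Functor.map_smul, ha, Functor.map_zero]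

section HomotopyCategory

variable (R : Type u) [CommRing R]

/-- The homotopy category of cochain complexes of `R`-modules. -/
abbrev HoMod := HomotopyCategory (ModuleCat.{u} R) (ComplexShape.up ℤ)

/-- The projection functor from complexes to the homotopy category. -/
noncomputable abbrev toHoMod : CochainComplex (ModuleCat.{u} R) ℤ ⥤ HoMod R :=
  HomotopyCategory.quotient (ModuleCat.{u} R) (ComplexShape.up ℤ)

/-- The cohomology functors on the homotopy category. -/
noncomputable abbrev hoH (i : ℤ) : HoMod R ⥤ ModuleCat.{u} R :=
  HomotopyCategory.homologyFunctor (ModuleCat.{u} R) (ComplexShape.up ℤ) i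

variable {R}

/-- The connecting map of the long exact cohomology sequence. -/
noncomputable def hoδ (Tr : Triangle (HoMod R)) (i j : ℤ) (h : i + 1 = j) :
    (hoH R i).obj Tr.obj₃ ⟶ (hoH R j).obj Tr.obj₁ :=
  (hoH R 0).homologySequenceδ Tr i j h

lemma hoH_exact₂ {Tr : Triangle (HoMod R)} (hTr : Tr ∈ distTriang (HoMod R)) (i : ℤ) :
    Function.Exact ((hoH R i).map Tr.mor₁) ((hoH R i).map Tr.mor₂) :=
  (ShortComplex.ShortExact.moduleCat_exact_iff_function_exact _).1
    ((hoH R 0).homologySequence_exact₂ Tr hTr i)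

lemma hoH_exact₃ {Tr : Triangle (HoMod R)} (hTr : Tr ∈ distTriang (HoMod R)) (i j : ℤ)
    (h : i + 1 = j) :
    Function.Exact ((hoH R i).map Tr.mor₂) (hoδ Tr i j h) :=
  (ShortComplex.ShortExact.moduleCat_exact_iff_function_exact _).1
    ((hoH R 0).homologySequence_exact₃ Tr hTr i j h)

lemma hoH_exact₁ {Tr : Triangle (HoMod R)} (hTr : Tr ∈ distTriang (HoMod R)) (i j : ℤ)
    (h : i + 1 = j) :
    Function.Exact (hoδ Tr i j h) ((hoH R j).map Tr.mor₁) :=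
  (ShortComplex.ShortExact.moduleCat_exact_iff_function_exact _).1
    ((hoH R 0).homologySequence_exact₁ Tr hTr i j h)

lemma subsingleton_of_exact {M₁ M₂ M₃ : ModuleCat.{u} R} {a : M₁ ⟶ M₂} {b : M₂ ⟶ M₃}
    (h : Function.Exact a b) (h₁ : Subsingleton M₁) (h₃ : Subsingleton M₃) :
    Subsingleton M₂ := by
  refine subsingleton_of_forall_eq 0 fun x ↦ ?_
  obtain ⟨y, rfl⟩ := (h x).1 (Subsingleton.elim _ _)
  rw [Subsingleton.elim y 0, map_zero]

/-- The cohomology of `X` vanishes in degrees at least `n`. -/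
def AcyclicFrom (n : ℤ) (X : HoMod R) : Prop := ∀ i, n ≤ i → Subsingleton ((hoH R i).obj X)

lemma AcyclicFrom.mono {n n' : ℤ} (h : n ≤ n') {X : HoMod R} (hX : AcyclicFrom n X) :
    AcyclicFrom n' X := fun i hi ↦ hX i (h.trans hi)

lemma subsingleton_hoH_of_isZero {X : HoMod R} (hX : IsZero X) (i : ℤ) :
    Subsingleton ((hoH R i).obj X) :=
  ModuleCat.subsingleton_of_isZero ((hoH R i).map_isZero hX)

lemma AcyclicFrom.ext {n : ℤ} {Tr : Triangle (HoMod R)} (hTr : Tr ∈ distTriang (HoMod R))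
    (h₁ : AcyclicFrom n Tr.obj₁) (h₃ : AcyclicFrom n Tr.obj₃) : AcyclicFrom n Tr.obj₂ :=
  fun i hi ↦ subsingleton_of_exact (hoH_exact₂ hTr i) (h₁ i hi) (h₃ i hi)

lemma AcyclicFrom.cone {n : ℤ} {Tr : Triangle (HoMod R)} (hTr : Tr ∈ distTriang (HoMod R))
    (h₁ : AcyclicFrom (n + 1) Tr.obj₁) (h₂ : AcyclicFrom n Tr.obj₂) :
    AcyclicFrom n Tr.obj₃ :=
  fun i hi ↦ subsingleton_of_exact (hoH_exact₃ hTr i _ rfl) (h₂ i hi) (h₁ _ (by lia))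

lemma AcyclicFrom.fiber {n : ℤ} {Tr : Triangle (HoMod R)} (hTr : Tr ∈ distTriang (HoMod R))
    (h₂ : AcyclicFrom (n + 1) Tr.obj₂) (h₃ : AcyclicFrom n Tr.obj₃) :
    AcyclicFrom (n + 1) Tr.obj₁ :=
  fun i hi ↦ subsingleton_of_exact (hoH_exact₁ hTr (i - 1) i (by lia)) (h₃ _ (by lia)) (h₂ i hi)

/-- The isomorphism `H^i(X⟦n⟧) ≅ H^j(X)` for `n + i = j`. -/
noncomputable def hoHShiftIso (X : HoMod R) (n i j : ℤ) (h : n + i = j) :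
    (hoH R i).obj (X⟦n⟧) ≅ (hoH R j).obj X :=
  ((hoH R 0).shiftIso n i j h).app X

lemma AcyclicFrom.shift {n : ℤ} {X : HoMod R} (hX : AcyclicFrom n X) (k n' : ℤ)
    (h : k + n' = n) : AcyclicFrom n' (X⟦k⟧) := fun i hi ↦
  have := hX (k + i) (by lia)
  (hoHShiftIso X k i _ rfl).toLinearEquiv.toEquiv.subsingleton

lemma AcyclicFrom.of_iso {n : ℤ} {X Y : HoMod R} (hX : AcyclicFrom n X) (e : X ≅ Y) :
    AcyclicFrom n Y := fun i hi ↦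
  have := hX i hi
  ((hoH R i).mapIso e).symm.toLinearEquiv.toEquiv.subsingleton

/-- Every element of `M` is annihilated by a power of `f`. -/
def LocPowTorsion (f : R) (M : Type u) [AddCommGroup M] [Module R M] : Prop :=
  ∀ x : M, ∃ N : ℕ, f ^ N • x = 0

lemma LocPowTorsion.of_exact {f : R} {M₁ M₂ M₃ : ModuleCat.{u} R} {a : M₁ ⟶ M₂} {b : M₂ ⟶ M₃}
    (h : Function.Exact a b) (h₁ : LocPowTorsion f M₁) (h₃ : LocPowTorsion f M₃) :
    LocPowTorsion f M₂ := by
  intro x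
  obtain ⟨N, hN⟩ := h₃ (b x)
  obtain ⟨y, hy⟩ := (h (f ^ N • x)).1 (by rw [map_smul, hN])
  obtain ⟨N', hN'⟩ := h₁ y
  exact ⟨N' + N, by rw [pow_add, mul_smul, ← hy, ← map_smul, hN', map_zero]⟩

instance (i : ℤ) :
    (HomologicalComplex.homologyFunctor (ModuleCat.{u} R) (ComplexShape.up ℤ) i).Linear R where
  map_smul φ r := ShortComplex.homologyMap_smul
    ((HomologicalComplex.shortComplexFunctor (ModuleCat.{u} R) (ComplexShape.up ℤ) i).map φ) r

instance (i : ℤ) : (hoH R i).Linear R :=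
  have := Functor.linear_of_iso (R := R)
    (HomotopyCategory.homologyFunctorFactors (ModuleCat.{u} R) (ComplexShape.up ℤ) i).symm
  Functor.linear_of_full_essSurj_comp (toHoMod R) _

lemma IsPowTorsion.locPowTorsion_hoH {f : R} {X : HoMod R} (hX : IsPowTorsion f X) (i : ℤ) :
    LocPowTorsion f ((hoH R i).obj X) := by
  obtain ⟨N, hN⟩ := hX
  refine fun x ↦ ⟨N, ?_⟩
  have h : f ^ N • 𝟙 ((hoH R i).obj X) = 0 := by
    rw [← CategoryTheory.Functor.map_id, ← Functor.map_smul, hN, Functor.map_zero]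
  exact congr_arg (fun φ ↦ φ.hom x) h

end HomotopyCategory

section Koszul

variable {R : Type u} [CommRing R]

/-- The cohomology of a complex agrees with that of its class in the homotopy category. -/
noncomputable def hoHIso (X : CochainComplex (ModuleCat.{u} R) ℤ) (i : ℤ) :
    (hoH R i).obj ((toHoMod R).obj X) ≅ X.homology i :=
  (HomotopyCategory.homologyFunctorFactors (ModuleCat.{u} R) (ComplexShape.up ℤ) i).app X

lemma hoHIso_naturality {X Y : CochainComplex (ModuleCat.{u} R) ℤ} (φ : X ⟶ Y) (i : ℤ) :
    (hoH R i).map ((toHoMod R).map φ) ≫ (hoHIso Y i).hom =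
      (hoHIso X i).hom ≫ HomologicalComplex.homologyMap φ i :=
  (HomotopyCategory.homologyFunctorFactors (ModuleCat.{u} R) (ComplexShape.up ℤ) i).hom.naturality φ

lemma subsingleton_hoH_iff (X : CochainComplex (ModuleCat.{u} R) ℤ) (i : ℤ) :
    Subsingleton ((hoH R i).obj ((toHoMod R).obj X)) ↔ IsZero (X.homology i) := by
  rw [← (hoHIso X i).isZero_iff]
  exact (ModuleCat.isZero_iff_subsingleton).symm

lemma subsingleton_hoH_of_isZero_X (X : CochainComplex (ModuleCat.{u} R) ℤ) (i : ℤ)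
    (h : IsZero (X.X i)) : Subsingleton ((hoH R i).obj ((toHoMod R).obj X)) := by
  rw [subsingleton_hoH_iff, ← HomologicalComplex.exactAt_iff_isZero_homology]
  exact ShortComplex.exact_of_isZero_X₂ _ h

/-- The class of the Koszul complex in the homotopy category. -/
noncomputable abbrev hoKoszul (l : List R) : HoMod R := (toHoMod R).obj (koszul R l)

lemma exists_hoKoszul_triangle (f : R) (l : List R) :
    ∃ (u : hoKoszul l ⟶ hoKoszul (f :: l)) (w : hoKoszul (f :: l) ⟶ (hoKoszul l)⟦(1 : ℤ)⟧),
      Triangle.mk (f • 𝟙 (hoKoszul l)) u w ∈ distTriang (HoMod R) := by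
  have h := HomotopyCategory.mappingCone_triangleh_distinguished (f • 𝟙 (koszul R l))
  have e : f • 𝟙 (hoKoszul l) = (toHoMod R).map (f • 𝟙 (koszul R l)) := by
    rw [Functor.map_smul, CategoryTheory.Functor.map_id]
  rw [e]
  exact ⟨_, _, h⟩

lemma exists_hoKoszul_triangle_shift (f : R) (l : List R) (k : ℤ) :
    ∃ (a : (hoKoszul l)⟦k⟧ ⟶ (hoKoszul l)⟦k⟧) (u : (hoKoszul l)⟦k⟧ ⟶ (hoKoszul (f :: l))⟦k⟧)
      (w : (hoKoszul (f :: l))⟦k⟧ ⟶ ((hoKoszul l)⟦k⟧)⟦(1 : ℤ)⟧),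
      Triangle.mk a u w ∈ distTriang (HoMod R) ∧
        ∀ (E : HoMod R) (φ : (hoKoszul l)⟦k⟧ ⟶ E), f • φ = 0 → a ≫ φ = 0 := by
  obtain ⟨u, w, h⟩ := exists_hoKoszul_triangle f l
  refine ⟨_, _, _, Triangle.shift_distinguished _ h k, fun E φ hφ ↦ ?_⟩
  change (k.negOnePow • (f • 𝟙 (hoKoszul l))⟦k⟧') ≫ φ = 0
  rw [Functor.map_smul, CategoryTheory.Functor.map_id, Linear.units_smul_comp, Linear.smul_comp,
    Category.id_comp, hφ, smul_zero]

lemma isPowTorsion_hoKoszul {f : R} {l : List R} (hf : f ∈ l) : IsPowTorsion f (hoKoszul l) := by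
  induction l with
  | nil => simp at hf
  | cons f' l ih =>
    obtain ⟨u, w, h⟩ := exists_hoKoszul_triangle f' l
    have hr := rot_of_distTriang _ h
    rcases List.mem_cons.1 hf with rfl | hf
    · refine ⟨2, ?_⟩
      rw [pow_two]
      refine smul_id_eq_zero_of_distinguished hr ?_ ?_
      · have h₀ : (f • 𝟙 (hoKoszul l)) ≫ u = 0 := comp_distTriang_mor_zero₁₂ _ h
        rwa [Linear.smul_comp, Category.id_comp] at h₀
      · have h₀ : w ≫ (f • 𝟙 (hoKoszul l))⟦(1 : ℤ)⟧' = 0 := comp_distTriang_mor_zero₃₁ _ h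
        rwa [Functor.map_smul, CategoryTheory.Functor.map_id, Linear.comp_smul,
          Category.comp_id] at h₀
    · exact IsPowTorsion.ext hr (ih hf) ((ih hf).shift 1)

lemma acyclicFrom_hoKoszul (l : List R) : AcyclicFrom 1 (hoKoszul l) := by
  induction l with
  | nil =>
    exact fun i hi ↦ subsingleton_hoH_of_isZero_X (singleR R) i
      (HomologicalComplex.isZero_single_obj_X (ComplexShape.up ℤ) _ _ _ (by lia))
  | cons f l ih =>
    obtain ⟨u, w, h⟩ := exists_hoKoszul_triangle f l
    exact AcyclicFrom.cone h (ih.mono (by lia)) ih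

lemma isPowTorsion_of_smnMem {f : R} {l : List R} (hf : f ∈ l) {a b : ℤ} {P : HoMod R}
    (hP : SmnMem {hoKoszul l} a b P) : IsPowTorsion f P := by
  induction hP with
  | zero Z hZ => exact ⟨0, hZ.eq_of_src _ _⟩
  | shift E hE ℓ h₁ h₂ =>
    obtain rfl : E = hoKoszul l := hE
    exact (isPowTorsion_hoKoszul hf).shift _
  | ext Tr hTr _ _ ih₁ ih₃ => exact .ext hTr ih₁ ih₃

lemma acyclicFrom_of_smnMem {l : List R} {a b : ℤ} {P : HoMod R}
    (hP : SmnMem {hoKoszul l} a b P) : AcyclicFrom (b + 1) P := by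
  induction hP with
  | zero Z hZ => exact fun i _ ↦ subsingleton_hoH_of_isZero hZ i
  | shift E hE ℓ h₁ h₂ =>
    obtain rfl : E = hoKoszul l := hE
    exact ((acyclicFrom_hoKoszul l).shift (-ℓ) (ℓ + 1) (by lia)).mono (by lia)
  | ext Tr hTr _ _ ih₁ ih₃ => exact .ext hTr ih₁ ih₃

end Koszul

section Corepresentability

variable {R : Type u} [CommRing R]

open HomologicalComplex CochainComplex.HomComplex

lemma toHoMod_map_eq_zero_of_single {A : ModuleCat.{u} R} {q : ℤ}
    {E : CochainComplex (ModuleCat.{u} R) ℤ} (φ : (CochainComplex.singleFunctor _ q).obj A ⟶ E)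
    (y : A ⟶ E.X (q - 1))
    (h : (singleObjXSelf (ComplexShape.up ℤ) q A).inv ≫ φ.f q = y ≫ E.d (q - 1) q) :
    (toHoMod R).map φ = 0 := by
  rw [HomotopyCategory.quotient_map_eq_zero_iff]
  refine ⟨(Cochain.equivHomotopy φ 0).symm
    ⟨Cochain.fromSingleMk (p := q) (n := -1) y (by lia), ?_⟩⟩
  rw [Cochain.δ_fromSingleMk y (by lia) 0 q (by lia), ← h, Cochain.ofHom_zero, add_zero]
  apply (Cochain.fromSingleEquiv (K := E) (p := q) (n := 0) (q := q) (by lia)).injective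
  rw [Cochain.fromSingleEquiv_fromSingleMk]
  simp [Cochain.fromSingleEquiv]

lemma singleObjHomologySelfIso_inv_comp_homologyMap {A : ModuleCat.{u} R} {q : ℤ}
    {E : CochainComplex (ModuleCat.{u} R) ℤ} (φ : (single _ (ComplexShape.up ℤ) q).obj A ⟶ E) :
    (singleObjHomologySelfIso _ q A).inv ≫ homologyMap φ q =
      ((singleObjCyclesSelfIso _ q A).inv ≫ cyclesMap φ q) ≫ E.homologyπ q := by
  rw [← singleObjCyclesSelfIso_inv_homologyπ, Category.assoc, homologyπ_naturality, Category.assoc]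

lemma singleObjCyclesSelfIso_inv_comp_cyclesMap_comp_iCycles {A : ModuleCat.{u} R} {q : ℤ}
    {E : CochainComplex (ModuleCat.{u} R) ℤ} (φ : (single _ (ComplexShape.up ℤ) q).obj A ⟶ E) :
    ((singleObjCyclesSelfIso _ q A).inv ≫ cyclesMap φ q) ≫ E.iCycles q =
      (singleObjXSelf (ComplexShape.up ℤ) q A).inv ≫ φ.f q := by
  rw [Category.assoc, cyclesMap_i, singleObjCyclesSelfIso_inv_iCycles_assoc]

lemma toHoMod_map_eq_zero_of_homologyMap_eq_zero {A : ModuleCat.{u} R} [Projective A] {q : ℤ}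
    {E : CochainComplex (ModuleCat.{u} R) ℤ} (φ : (single _ (ComplexShape.up ℤ) q).obj A ⟶ E)
    (h : (singleObjHomologySelfIso _ q A).inv ≫ homologyMap φ q = 0) :
    (toHoMod R).map φ = 0 := by
  rw [singleObjHomologySelfIso_inv_comp_homologyMap] at h
  have hS : (ShortComplex.mk _ _ (E.toCycles_comp_homologyπ (q - 1) q)).Exact :=
    ShortComplex.exact_of_g_is_cokernel _ (E.homologyIsCokernel (q - 1) q (by simp))
  refine toHoMod_map_eq_zero_of_single φ (hS.liftFromProjective _ h) ?_
  rw [← singleObjCyclesSelfIso_inv_comp_cyclesMap_comp_iCycles, ← E.toCycles_i, ← Category.assoc]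
  congr 1
  exact (hS.liftFromProjective_comp _ h).symm

lemma exists_map_eq_of_single {A : ModuleCat.{u} R} {q : ℤ}
    {E : CochainComplex (ModuleCat.{u} R) ℤ} (z : A ⟶ E.cycles q) :
    ∃ φ : (single _ (ComplexShape.up ℤ) q).obj A ⟶ E,
      (singleObjHomologySelfIso _ q A).inv ≫ homologyMap φ q = z ≫ E.homologyπ q := by
  refine ⟨mkHomFromSingle (z ≫ E.iCycles q) (by simp), ?_⟩
  rw [singleObjHomologySelfIso_inv_comp_homologyMap]
  congr 1
  rw [← cancel_mono (E.iCycles q), singleObjCyclesSelfIso_inv_comp_cyclesMap_comp_iCycles,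
    mkHomFromSingle_f, Iso.inv_hom_id_assoc]

/-- `X` corepresents `H^q` on the homotopy category, through the class `e`. -/
def IsHoUniversal (X : HoMod R) (q : ℤ) (e : (hoH R q).obj X) : Prop :=
  ∀ E : HoMod R, (∀ x : (hoH R q).obj E, ∃ φ : X ⟶ E, (hoH R q).map φ e = x) ∧
    ∀ φ : X ⟶ E, (hoH R q).map φ e = 0 → φ = 0

lemma IsHoUniversal.of_iso {X Y : HoMod R} {q : ℤ} {e : (hoH R q).obj X}
    (h : IsHoUniversal X q e) (i : X ≅ Y) : IsHoUniversal Y q ((hoH R q).map i.hom e) := by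
  refine fun E ↦ ⟨fun x ↦ ?_, fun φ hφ ↦ ?_⟩
  · obtain ⟨φ, hφ⟩ := (h E).1 x
    exact ⟨i.inv ≫ φ, by simp [← hφ, ← ConcreteCategory.comp_apply, ← Functor.map_comp]⟩
  · rw [← cancel_epi i.hom, comp_zero]
    exact (h E).2 _ (by simpa using hφ)

lemma isHoUniversal_single (q : ℤ) :
    IsHoUniversal ((toHoMod R).obj ((single _ (ComplexShape.up ℤ) q).obj (ModuleCat.of R R))) q
      ((hoHIso _ q).inv ((singleObjHomologySelfIso _ q (ModuleCat.of R R)).inv (1 : R))) := by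
  intro E
  obtain ⟨E, rfl⟩ := HomotopyCategory.quotient_obj_surjective E
  have key : ∀ φ : (single _ (ComplexShape.up ℤ) q).obj (ModuleCat.of R R) ⟶ E,
      (hoHIso E q).hom ((hoH R q).map ((toHoMod R).map φ) ((hoHIso _ q).inv
        ((singleObjHomologySelfIso _ q (ModuleCat.of R R)).inv (1 : R)))) =
      ((singleObjHomologySelfIso _ q (ModuleCat.of R R)).inv ≫ homologyMap φ q) (1 : R) := by
    intro φ
    rw [← ConcreteCategory.comp_apply, ← ConcreteCategory.comp_apply,
      ← ConcreteCategory.comp_apply, hoHIso_naturality, Iso.inv_hom_id_assoc]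
  refine ⟨fun x ↦ ?_, fun φ hφ ↦ ?_⟩
  · obtain ⟨z, hz⟩ := (ModuleCat.epi_iff_surjective (E.homologyπ q)).1 inferInstance
      ((hoHIso E q).hom x)
    obtain ⟨φ, hφ⟩ := exists_map_eq_of_single (ModuleCat.ofHom (LinearMap.toSpanSingleton R _ z))
    refine ⟨(toHoMod R).map φ, (hoHIso E q).toLinearEquiv.injective ?_⟩
    refine (key φ).trans ?_
    rw [hφ]
    change E.homologyπ q ((1 : R) • z) = _
    rw [one_smul, hz]
    rfl
  · obtain ⟨φ, rfl⟩ := (toHoMod R).map_surjective φ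
    apply toHoMod_map_eq_zero_of_homologyMap_eq_zero
    ext
    refine (key φ).symm.trans ?_
    rw [hφ, map_zero]
    rfl

/-- The shifted ring corepresents cohomology. -/
lemma exists_isHoUniversal (q : ℤ) :
    ∃ e, IsHoUniversal ((hoKoszul ([] : List R))⟦-q⟧) q e := by
  have i : (toHoMod R).obj ((single _ (ComplexShape.up ℤ) q).obj (ModuleCat.of R R)) ≅
      (hoKoszul ([] : List R))⟦-q⟧ :=
    (((HomotopyCategory.singleFunctors (ModuleCat.{u} R)).shiftIso (-q) q 0
      (by lia)).app (ModuleCat.of R R)).symm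
  exact ⟨_, (isHoUniversal_single q).of_iso i⟩

end Corepresentability

section Killing

variable {R : Type u} [CommRing R]

/-- The cohomology of `E` in degrees at least `n` is locally torsion for each element of `l`. -/
def TorsionFrom (l : List R) (n : ℤ) (E : HoMod R) : Prop :=
  ∀ f ∈ l, ∀ i, n ≤ i → LocPowTorsion f ((hoH R i).obj E)

lemma TorsionFrom.of_hasFiberIn {l : List R} {n a b : ℤ} {E C : HoMod R} {g : E ⟶ C}
    (hE : TorsionFrom l n E) (hg : HasFiberIn (SmnMem {hoKoszul l} a b) g) :
    TorsionFrom l n C := by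
  obtain ⟨P, i, h, hP, hT⟩ := hg
  exact fun f hf j hj ↦ .of_exact (hoH_exact₃ hT j _ rfl) (hE f hf j hj)
    ((isPowTorsion_of_smnMem hf hP).locPowTorsion_hoH _)

lemma exists_pow_smul_eq_zero {f : R} {n : ℤ} {E : HoMod R}
    (hE : ∀ i, n ≤ i → LocPowTorsion f ((hoH R i).obj E)) (l : List R) {q : ℤ}
    (hq : n + l.length ≤ q) (φ : (hoKoszul l)⟦-q⟧ ⟶ E) : ∃ N : ℕ, f ^ N • φ = 0 := by
  induction l generalizing q with
  | nil =>
    obtain ⟨e, he⟩ := exists_isHoUniversal (R := R) q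
    obtain ⟨N, hN⟩ := hE q (by simpa using hq) ((hoH R q).map φ e)
    refine ⟨N, (he E).2 _ ?_⟩
    rw [Functor.map_smul]
    exact hN
  | cons f' l ih =>
    rw [List.length_cons] at hq
    push_cast at hq
    obtain ⟨a, u, w, hT, -⟩ := exists_hoKoszul_triangle_shift f' l (-q)
    obtain ⟨N, hN⟩ := ih (by lia) (u ≫ φ)
    obtain ⟨χ, hχ⟩ : ∃ χ : ((hoKoszul l)⟦-q⟧)⟦(1 : ℤ)⟧ ⟶ E, f ^ N • φ = w ≫ χ :=
      Triangle.yoneda_exact₃ _ hT (f ^ N • φ)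
        (by change u ≫ (f ^ N • φ) = 0; rw [Linear.comp_smul, hN])
    let i : (hoKoszul l)⟦-(q - 1)⟧ ≅ ((hoKoszul l)⟦-q⟧)⟦(1 : ℤ)⟧ :=
      (shiftFunctorAdd' (HoMod R) (-q) 1 (-(q - 1)) (by lia)).app (hoKoszul l)
    obtain ⟨M, hM⟩ := ih (by lia) (i.hom ≫ χ)
    rw [← Linear.comp_smul, Preadditive.IsIso.comp_left_eq_zero] at hM
    refine ⟨M + N, ?_⟩
    rw [pow_add, mul_smul, hχ, ← Linear.comp_smul, hM, comp_zero]

lemma exists_comp_eq_zero_of_reverseAux (L : List R) {n p : ℤ} (hp : n + L.length ≤ p)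
    (l' l : List R) (hl : l'.reverseAux l = L) {E : HoMod R} (hE : TorsionFrom L n E)
    (φ : (hoKoszul l)⟦-p⟧ ⟶ E) :
    ∃ (C : HoMod R) (g : E ⟶ C), HasFiberIn (SmnMem {hoKoszul L} p p) g ∧ φ ≫ g = 0 := by
  induction l' generalizing l E with
  | nil =>
    obtain rfl : l = L := hl
    obtain ⟨C, g, h, hT⟩ := distinguished_cocone_triangle φ
    exact ⟨C, g, ⟨_, φ, h, .shift _ (Set.mem_singleton _) p le_rfl le_rfl, hT⟩,
      comp_distTriang_mor_zero₁₂ _ hT⟩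
  | cons f l' ih =>
    have hmem : f ∈ L := by simp [← hl, List.reverseAux_eq]
    have hlen : l.length ≤ L.length := by simp [← hl, List.reverseAux_eq]; lia
    obtain ⟨a, u, w, hT, ha⟩ := exists_hoKoszul_triangle_shift f l (-p)
    obtain ⟨N, hN⟩ := exists_pow_smul_eq_zero (hE f hmem) l (by lia) φ
    induction N generalizing E with
    | zero => exact ⟨E, 𝟙 E, HasFiberIn.id (fun _ ↦ .zero _) E, by simpa using hN⟩
    | succ N ihN =>
      rw [pow_succ', mul_smul] at hN
      obtain ⟨ψ, hψ⟩ : ∃ ψ : (hoKoszul (f :: l))⟦-p⟧ ⟶ E, f ^ N • φ = u ≫ ψ :=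
        Triangle.yoneda_exact₂ _ hT (f ^ N • φ) (ha _ _ hN)
      obtain ⟨C₁, g₁, hg₁, hψg⟩ := ih (f :: l) hl hE ψ
      obtain ⟨C₂, g₂, hg₂, hφ⟩ := ihN (hE.of_hasFiberIn hg₁) (φ ≫ g₁) (by
        rw [← Linear.smul_comp, hψ, Category.assoc, hψg, comp_zero])
      exact ⟨C₂, g₁ ≫ g₂, hg₁.comp (fun Tr hTr ↦ .ext Tr hTr) hg₂, by simpa using hφ⟩

/-- A cohomology class in degree `p` dies in the quotient by an object built from Koszul
complexes. -/
lemma exists_map_eq_zero (L : List R) {n p : ℤ} (hp : n + L.length ≤ p) {E : HoMod R}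
    (hE : TorsionFrom L n E) (x : (hoH R p).obj E) :
    ∃ (C : HoMod R) (g : E ⟶ C),
      HasFiberIn (SmnMem {hoKoszul L} p p) g ∧ (hoH R p).map g x = 0 := by
  obtain ⟨e, he⟩ := exists_isHoUniversal (R := R) p
  obtain ⟨φ, rfl⟩ := (he E).1 x
  obtain ⟨C, g, hg, hφ⟩ := exists_comp_eq_zero_of_reverseAux L hp L.reverse []
    (by simp [List.reverseAux_eq]) hE φ
  refine ⟨C, g, hg, ?_⟩
  rw [← ConcreteCategory.comp_apply, ← Functor.map_comp, hφ, Functor.map_zero]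
  rfl

end Killing

section PseudoCoherent

lemma SmnMem.shift_obj {T : Type u} [Category.{v} T] [HasZeroObject T] [Preadditive T]
    [HasShift T ℤ] [∀ n : ℤ, (shiftFunctor T n).Additive] [Pretriangulated T] {S : Set T}
    {m n : ℤ} {X : T} (hX : SmnMem S m n X) {k m' n' : ℤ} (hm : m' + k ≤ m) (hn : n ≤ n' + k) :
    SmnMem S m' n' (X⟦k⟧) := by
  induction hX with
  | zero Z hZ => exact .zero _ ((shiftFunctor T k).map_isZero hZ)
  | shift E hE ℓ h₁ h₂ =>
    exact (SmnMem.shift E hE (ℓ - k) (by lia) (by lia)).of_iso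
      ((shiftFunctorAdd' T (-ℓ) k (-(ℓ - k)) (by lia)).app E)
  | ext Tr hTr _ _ ih₁ ih₃ => exact .ext _ (Triangle.shift_distinguished Tr hTr k) ih₁ ih₃

variable {R : Type u} [CommRing R]

/-- The class of a module placed in degree `q`. -/
noncomputable abbrev hoSingle (q : ℤ) (A : ModuleCat.{u} R) : HoMod R :=
  (toHoMod R).obj ((HomologicalComplex.single _ (ComplexShape.up ℤ) q).obj A)

/-- A module in degree `q` is a shift of the same module in degree `0`. -/
noncomputable def hoSingleIso (q : ℤ) (A : ModuleCat.{u} R) : (hoSingle 0 A)⟦-q⟧ ≅ hoSingle q A :=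
  ((HomotopyCategory.singleFunctors (ModuleCat.{u} R)).shiftIso (-q) q 0 (by lia)).app A

variable (R) in
/-- The finite projective modules placed in degree `0`. -/
def finProj : Set (HoMod R) :=
  {X | ∃ A : ModuleCat.{u} R, Module.Finite R A ∧ Module.Projective R A ∧ X = hoSingle 0 A}

lemma hom_eq_zero_of_smnMem_finProj {n b : ℤ} {F D : HoMod R} (hF : SmnMem (finProj R) n b F)
    (hD : AcyclicFrom n D) (φ : F ⟶ D) : φ = 0 := by
  induction hF with
  | zero Z hZ => exact hZ.eq_of_src _ _
  | shift E hE ℓ h₁ h₂ =>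
    obtain ⟨A, _, hA, rfl⟩ := hE
    obtain ⟨D, rfl⟩ := HomotopyCategory.quotient_obj_surjective D
    rw [← cancel_epi (hoSingleIso ℓ A).inv, comp_zero]
    obtain ⟨ψ, hψ⟩ := (toHoMod R).map_surjective ((hoSingleIso ℓ A).inv ≫ φ)
    rw [← hψ]
    have : Projective A := (IsProjective.iff_projective A).1 hA
    refine toHoMod_map_eq_zero_of_homologyMap_eq_zero ψ ?_
    exact ((subsingleton_hoH_iff D ℓ).1 (hD ℓ h₁)).eq_of_tgt _ _
  | ext Tr hTr _ _ ih₁ ih₃ =>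
    obtain ⟨ψ, rfl⟩ := Triangle.yoneda_exact₂ _ hTr φ (ih₁ _)
    rw [ih₃ ψ, comp_zero]

/-- Up to an object with no cohomology in degrees at least `n`, the object `E` is built from
finite projective modules placed in degrees at least `n`. -/
def PseudoCoherentFrom (n : ℤ) (E : HoMod R) : Prop :=
  ∃ (D : HoMod R) (g : E ⟶ D) (b : ℤ), HasFiberIn (SmnMem (finProj R) n b) g ∧ AcyclicFrom n D

lemma PseudoCoherentFrom.of_acyclicFrom {n : ℤ} {E : HoMod R} (hE : AcyclicFrom n E) :
    PseudoCoherentFrom n E :=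
  ⟨E, 𝟙 E, n, HasFiberIn.id (fun _ ↦ .zero _) E, hE⟩

lemma PseudoCoherentFrom.of_cone {n : ℤ} {Tr : Triangle (HoMod R)}
    (hTr : Tr ∈ distTriang (HoMod R)) (h₁ : PseudoCoherentFrom n Tr.obj₁)
    (h₃ : AcyclicFrom n Tr.obj₃) : PseudoCoherentFrom n Tr.obj₂ := by
  obtain ⟨D, g, b, ⟨Q, i, h, hQ, hT⟩, hD⟩ := h₁
  obtain ⟨W, v, w, hW⟩ := distinguished_cocone_triangle (i ≫ Tr.mor₁)
  have o := Triangulated.someOctahedron rfl hT hTr hW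
  exact ⟨W, v, b, ⟨Q, _, w, hQ, hW⟩, AcyclicFrom.ext o.mem hD h₃⟩

lemma PseudoCoherentFrom.cone_of_smnMem_succ {n b : ℤ} {Tr : Triangle (HoMod R)}
    (hTr : Tr ∈ distTriang (HoMod R)) (h₁ : SmnMem (finProj R) (n + 1) b Tr.obj₁)
    (h₂ : PseudoCoherentFrom n Tr.obj₂) : PseudoCoherentFrom n Tr.obj₃ := by
  obtain ⟨D, g, b', ⟨Q, i, h, hQ, hT⟩, hD⟩ := h₂
  obtain ⟨β, hβ⟩ : ∃ β : Tr.obj₁ ⟶ Q, Tr.mor₁ = β ≫ i := Triangle.coyoneda_exact₂ _ hT Tr.mor₁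
    (hom_eq_zero_of_smnMem_finProj (h₁.mono (m' := n) (by lia) le_rfl) hD _)
  obtain ⟨Q', v, w, hQ'⟩ := distinguished_cocone_triangle β
  have o := Triangulated.someOctahedron hβ.symm hQ' hT hTr
  refine ⟨D, o.m₃, max b b', ⟨Q', o.m₁, _, ?_, o.mem⟩, hD⟩
  exact .ext _ (rot_of_distTriang _ hQ') (hQ.mono le_rfl (le_max_right _ _))
    (h₁.shift_obj (by lia) (by lia))

lemma PseudoCoherentFrom.cone_of_smnMem {n c d : ℤ} {X : HoMod R} (hX : SmnMem (finProj R) c d X)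
    {Y Z : HoMod R} {α : X ⟶ Y} {v : Y ⟶ Z} {w : Z ⟶ X⟦(1 : ℤ)⟧}
    (hT : Triangle.mk α v w ∈ distTriang (HoMod R)) (hY : PseudoCoherentFrom n Y) :
    PseudoCoherentFrom n Z := by
  induction hX generalizing Y Z with
  | zero X hX => exact cone_of_smnMem_succ (b := n) hT (.zero _ hX) hY
  | shift E hE ℓ h₁ h₂ =>
    by_cases hℓ : n + 1 ≤ ℓ
    · exact cone_of_smnMem_succ hT (.shift E hE ℓ hℓ le_rfl) hY
    · refine of_cone (rot_of_distTriang _ hT) hY ?_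
      obtain ⟨A, -, -, rfl⟩ := hE
      have hA : AcyclicFrom (ℓ + 1) (hoSingle ℓ A) := fun i hi ↦
        subsingleton_hoH_of_isZero_X _ i
          (HomologicalComplex.isZero_single_obj_X (ComplexShape.up ℤ) _ _ _ (by lia))
      exact ((hA.of_iso (hoSingleIso ℓ A).symm).shift 1 ℓ (by lia)).mono (by lia)
  | ext Tr hTr _ _ ih₁ ih₃ =>
    obtain ⟨Z₁, v₁, w₁, hZ₁⟩ := distinguished_cocone_triangle (Tr.mor₁ ≫ α)
    have o := Triangulated.someOctahedron rfl hTr hT hZ₁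
    exact ih₃ o.mem (ih₁ hZ₁ hY)

open scoped ZeroObject in
lemma PseudoCoherentFrom.of_smnMem {n c d : ℤ} {X : HoMod R} (hX : SmnMem (finProj R) c d X) :
    PseudoCoherentFrom n X := by
  have hT := inv_rot_of_distTriang _ (contractible_distinguished₁ X)
  have h0 : PseudoCoherentFrom n (0 : HoMod R) :=
    .of_acyclicFrom fun i _ ↦ subsingleton_hoH_of_isZero (isZero_zero _) i
  exact cone_of_smnMem (hX.shift_obj (k := -1) (m' := c + 1) (n' := d + 1) (by lia) (by lia)) hT h0

lemma exists_smnMem_finProj_hoKoszul (l : List R) :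
    ∃ c d, SmnMem (finProj R) c d (hoKoszul l) := by
  induction l with
  | nil =>
    have h : hoKoszul ([] : List R) ∈ finProj R :=
      ⟨ModuleCat.of R R, inferInstance, inferInstance, rfl⟩
    refine ⟨0, 0, (SmnMem.shift _ h 0 le_rfl le_rfl).of_iso ?_⟩
    exact (shiftFunctorZero' (HoMod R) (-0) (by simp)).app _
  | cons f l ih =>
    obtain ⟨c, d, h⟩ := ih
    obtain ⟨u, w, hT⟩ := exists_hoKoszul_triangle f l
    exact ⟨c - 1, d, .ext _ (rot_of_distTriang _ hT) (h.mono (by lia) le_rfl)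
      (h.shift_obj (by lia) (by lia))⟩

lemma exists_smnMem_finProj_of_smnMem_hoKoszul {l : List R} {a b : ℤ} {P : HoMod R}
    (hP : SmnMem {hoKoszul l} a b P) : ∃ c d, SmnMem (finProj R) c d P := by
  induction hP with
  | zero Z hZ => exact ⟨0, 0, .zero Z hZ⟩
  | shift E hE ℓ h₁ h₂ =>
    obtain rfl : E = hoKoszul l := hE
    obtain ⟨c, d, h⟩ := exists_smnMem_finProj_hoKoszul l
    exact ⟨c + ℓ, d + ℓ, h.shift_obj (by lia) (by lia)⟩
  | ext Tr hTr _ _ ih₁ ih₃ =>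
    obtain ⟨c, d, h⟩ := ih₁
    obtain ⟨c', d', h'⟩ := ih₃
    exact ⟨min c c', max d d', .ext Tr hTr (h.mono (min_le_left _ _) (le_max_left _ _))
      (h'.mono (min_le_right _ _) (le_max_right _ _))⟩

lemma PseudoCoherentFrom.of_hasFiberIn {l : List R} {n a b : ℤ} {E C : HoMod R} {g : E ⟶ C}
    (hE : PseudoCoherentFrom n E) (hg : HasFiberIn (SmnMem {hoKoszul l} a b) g) :
    PseudoCoherentFrom n C := by
  obtain ⟨P, i, h, hP, hT⟩ := hg
  obtain ⟨c, d, hP'⟩ := exists_smnMem_finProj_of_smnMem_hoKoszul hP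
  exact cone_of_smnMem hP' hT hE

end PseudoCoherent

section Bounded

variable {R : Type u} [CommRing R]

/-- The triangle which removes the top term of a bounded above complex. -/
lemma exists_removeTop_triangle (Q : CochainComplex (ModuleCat.{u} R) ℤ) (b : ℤ)
    (hQ : ∀ i, b < i → IsZero (Q.X i)) :
    ∃ (Q' : CochainComplex (ModuleCat.{u} R) ℤ) (α : hoSingle b (Q.X b) ⟶ (toHoMod R).obj Q)
      (β : (toHoMod R).obj Q ⟶ (toHoMod R).obj Q')
      (γ : (toHoMod R).obj Q' ⟶ (hoSingle b (Q.X b))⟦(1 : ℤ)⟧),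
      Triangle.mk α β γ ∈ distTriang (HoMod R) ∧ IsZero (Q'.X b) ∧
        ∀ i, i ≠ b → Nonempty (Q.X i ≅ Q'.X i) := by
  let ι : (HomologicalComplex.single _ (ComplexShape.up ℤ) b).obj (Q.X b) ⟶ Q :=
    HomologicalComplex.mkHomFromSingle (𝟙 (Q.X b)) fun k hk ↦
      (hQ k (by rw [ComplexShape.up_Rel] at hk; lia)).eq_of_tgt _ _
  have hb : IsIso (ι.f b) := by
    dsimp only [ι]
    rw [HomologicalComplex.mkHomFromSingle_f]
    infer_instance
  have h0 : ∀ i, i ≠ b → IsZero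
      (((HomologicalComplex.single _ (ComplexShape.up ℤ) b).obj (Q.X b)).X i) := fun i hi ↦
    HomologicalComplex.isZero_single_obj_X (ComplexShape.up ℤ) _ _ _ hi
  have : Mono ι := by
    have : ∀ i, Mono (ι.f i) := fun i ↦ by
      by_cases hi : i = b
      · subst hi; infer_instance
      · exact (h0 i hi).mono _
    exact HomologicalComplex.mono_of_mono_f ι this
  let S := ShortComplex.mk ι (cokernel.π ι) (cokernel.condition ι)
  have hS : S.ShortExact := { exact := ShortComplex.exact_cokernel ι }
  have hSi (i : ℤ) : (S.map (HomologicalComplex.eval _ _ i)).ShortExact := hS.map_of_exact _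
  have hzero : IsZero (S.map (HomologicalComplex.eval _ _ b)).X₃ := (hSi b).isIso_f_iff.1 hb
  have hiso (i : ℤ) (hi : i ≠ b) : IsIso (S.map (HomologicalComplex.eval _ _ i)).g :=
    (hSi i).isIso_g_iff.2 (h0 i hi)
  have σ : ∀ i, (S.map (HomologicalComplex.eval _ _ i)).Splitting := fun i ↦ by
    by_cases hi : i = b
    · subst hi
      exact .ofIsIsoOfIsZero _ hb hzero
    · exact .ofIsZeroOfIsIso _ (h0 i hi) (hiso i hi)
  refine ⟨cokernel ι, _, _, _, (HomotopyCategory.distinguished_iff_iso_trianglehOfDegreewiseSplit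
    (CochainComplex.trianglehOfDegreewiseSplit S σ)).2 ⟨S, σ, ⟨Iso.refl _⟩⟩, hzero, fun i hi ↦ ?_⟩
  exact ⟨@asIso _ _ _ _ _ (hiso i hi)⟩

lemma exists_smnMem_finProj_of_bounded (N : ℕ) {a : ℤ} {Q : CochainComplex (ModuleCat.{u} R) ℤ}
    (hQ : ∀ i, (i < a ∨ a + N ≤ i) → IsZero (Q.X i))
    (hQ' : ∀ i, Module.Finite R (Q.X i) ∧ Module.Projective R (Q.X i)) :
    ∃ c d, SmnMem (finProj R) c d ((toHoMod R).obj Q) := by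
  induction N generalizing Q with
  | zero =>
    refine ⟨0, 0, .zero _ ((toHoMod R).map_isZero ?_)⟩
    refine (IsZero.iff_id_eq_zero _).2
      (HomologicalComplex.hom_ext _ _ fun i ↦ (hQ i ?_).eq_of_src _ _)
    lia
  | succ N ih =>
    push_cast at hQ
    obtain ⟨Q', α, β, γ, hT, h0, e⟩ := exists_removeTop_triangle Q (a + N)
      (fun i hi ↦ hQ i (by lia))
    obtain ⟨c, d, h⟩ := ih (Q := Q') (fun i hi ↦ by
      by_cases hi' : i = a + N
      · rwa [hi']
      · obtain ⟨e⟩ := e i hi'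
        exact (hQ i (by lia)).of_iso e.symm) (fun i ↦ by
      by_cases hi' : i = a + N
      · rw [hi']
        have := ModuleCat.subsingleton_of_isZero h0
        exact ⟨inferInstance, inferInstance⟩
      · obtain ⟨e⟩ := e i hi'
        obtain ⟨_, _⟩ := hQ' i
        exact ⟨Module.Finite.equiv e.toLinearEquiv, Module.Projective.of_equiv e.toLinearEquiv⟩)
    have hs : SmnMem (finProj R) (a + N) (a + N) (hoSingle (a + N) (Q.X (a + N))) :=
      (SmnMem.shift (S := finProj R) _ ⟨_, (hQ' _).1, (hQ' _).2, rfl⟩ _ le_rfl le_rfl).of_iso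
        (hoSingleIso _ _)
    exact ⟨min (a + N) c, max (a + N) d, .ext _ hT
      (hs.mono (min_le_left _ _) (le_max_left _ _)) (h.mono (min_le_right _ _) (le_max_right _ _))⟩

lemma acyclicFrom_of_bijective_surjective {n : ℤ} {Tr : Triangle (HoMod R)}
    (hTr : Tr ∈ distTriang (HoMod R))
    (hb : ∀ j, n < j → Function.Injective ((hoH R j).map Tr.mor₁))
    (hs : ∀ j, n ≤ j → Function.Surjective ((hoH R j).map Tr.mor₁)) :
    AcyclicFrom n Tr.obj₃ := by
  intro i hi
  refine subsingleton_of_forall_eq 0 fun x ↦ ?_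
  have hx : hoδ Tr i _ rfl x = 0 := by
    apply hb (i + 1) (by lia)
    rw [map_zero]
    exact (hoH_exact₁ hTr i _ rfl).apply_apply_eq_zero x
  obtain ⟨y, rfl⟩ := (hoH_exact₃ hTr i _ rfl x).1 hx
  obtain ⟨z, rfl⟩ := hs i hi y
  exact (hoH_exact₂ hTr i).apply_apply_eq_zero z

lemma bijective_hoH_map_iff {X Y : CochainComplex (ModuleCat.{u} R) ℤ} (φ : X ⟶ Y) (i : ℤ) :
    (Function.Injective ((hoH R i).map ((toHoMod R).map φ)) ↔
      Function.Injective (HomologicalComplex.homologyMap φ i)) ∧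
    (Function.Surjective ((hoH R i).map ((toHoMod R).map φ)) ↔
      Function.Surjective (HomologicalComplex.homologyMap φ i)) := by
  simp only [← ModuleCat.mono_iff_injective, ← ModuleCat.epi_iff_surjective]
  let e : Arrow.mk ((hoH R i).map ((toHoMod R).map φ)) ≅
      Arrow.mk (HomologicalComplex.homologyMap φ i) :=
    Arrow.isoMk (hoHIso X i) (hoHIso Y i) (hoHIso_naturality φ i).symm
  exact ⟨(MorphismProperty.monomorphisms _).arrow_mk_iso_iff e,
    (MorphismProperty.epimorphisms _).arrow_mk_iso_iff e⟩

lemma pseudoCoherentFrom_of_map {m a b : ℤ} {Q E : CochainComplex (ModuleCat.{u} R) ℤ}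
    (hQ : ∀ i, (i < a ∨ b < i) → IsZero (Q.X i))
    (hQ' : ∀ i, Module.Finite R (Q.X i) ∧ Module.Projective R (Q.X i)) (ξ : Q ⟶ E)
    (h₁ : ∀ j, m < j → Function.Bijective (HomologicalComplex.homologyMap ξ j))
    (h₂ : Function.Surjective (HomologicalComplex.homologyMap ξ m)) :
    PseudoCoherentFrom m ((toHoMod R).obj E) := by
  obtain ⟨c, d, h⟩ := exists_smnMem_finProj_of_bounded (b + 1 - a).toNat (a := a)
    (fun i hi ↦ hQ i (by lia)) hQ'
  obtain ⟨W, v, w, hT⟩ := distinguished_cocone_triangle ((toHoMod R).map ξ)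
  refine PseudoCoherentFrom.of_cone hT (.of_smnMem h)
    (acyclicFrom_of_bijective_surjective hT (fun j hj ↦ ?_) fun j hj ↦ ?_)
  · exact (bijective_hoH_map_iff ξ j).1.2 (h₁ j hj).1
  · rcases hj.lt_or_eq with hj | rfl
    · exact (bijective_hoH_map_iff ξ j).2.2 (h₁ j hj).2
    · exact (bijective_hoH_map_iff ξ _).2.2 h₂

end Bounded

section Finiteness

variable {R : Type u} [CommRing R]

open HomologicalComplex

/-- The morphism of classes induced by a linear map between modules in degree `q`. -/
noncomputable abbrev hoSingleMap (q : ℤ) {A B : ModuleCat.{u} R} (g : A ⟶ B) :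
    hoSingle q A ⟶ hoSingle q B :=
  (toHoMod R).map ((HomologicalComplex.single _ (ComplexShape.up ℤ) q).map g)

lemma exists_single_comp_eq_zero (q ℓ : ℤ) (A M : ModuleCat.{u} R) [Module.Finite R A]
    (φ : hoSingle ℓ A ⟶ hoSingle q M) :
    ∃ (M' : ModuleCat.{u} R) (g : M ⟶ M'), Function.Surjective g ∧
      (LinearMap.ker g.hom).FG ∧ φ ≫ hoSingleMap q g = 0 := by
  obtain ⟨ψ, rfl⟩ := (toHoMod R).map_surjective φ
  by_cases hℓ : ℓ = q
  · subst hℓ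
    let θ : A ⟶ M := (singleObjXSelf (ComplexShape.up ℤ) ℓ A).inv ≫ ψ.f ℓ ≫
      (singleObjXSelf (ComplexShape.up ℤ) ℓ M).hom
    let g : M ⟶ ModuleCat.of R (M ⧸ LinearMap.range θ.hom) :=
      ModuleCat.ofHom (LinearMap.range θ.hom).mkQ
    have hg : θ ≫ g = 0 := by
      ext x
      exact (Submodule.Quotient.mk_eq_zero _).2 ⟨x, rfl⟩
    have h : ψ ≫ (single _ (ComplexShape.up ℤ) ℓ).map g = 0 := by
      apply from_single_hom_ext
      rw [← cancel_epi (singleObjXSelf (ComplexShape.up ℤ) ℓ A).inv, comp_f, single_map_f_self]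
      rw [← Category.assoc (ψ.f ℓ), ← Category.assoc _ (ψ.f ℓ ≫ _), ← Category.assoc _ g]
      change (θ ≫ g) ≫ _ = _
      rw [hg, zero_comp, zero_f, comp_zero]
    refine ⟨_, g, Submodule.mkQ_surjective _, ?_, ?_⟩
    · change (LinearMap.ker (LinearMap.range θ.hom).mkQ).FG
      rw [Submodule.ker_mkQ]
      exact Submodule.FG.of_finite
    · rw [← Functor.map_comp, h, Functor.map_zero]
  · refine ⟨M, 𝟙 M, Function.surjective_id, ?_, ?_⟩
    · change (LinearMap.ker LinearMap.id).FG
      rw [LinearMap.ker_id]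
      exact Submodule.fg_bot
    · have : ψ = 0 := from_single_hom_ext
        ((isZero_single_obj_X (ComplexShape.up ℤ) _ _ _ hℓ).eq_of_tgt _ _)
      rw [this, Functor.map_zero, zero_comp]

/-- Every morphism from an object built from finite projective modules to a module in degree `q`
vanishes after quotienting by a finitely generated submodule. -/
lemma exists_comp_hoSingleMap_eq_zero {c d : ℤ} {F : HoMod R} (hF : SmnMem (finProj R) c d F)
    (q : ℤ) (M : ModuleCat.{u} R) (φ : F ⟶ hoSingle q M) :
    ∃ (M' : ModuleCat.{u} R) (g : M ⟶ M'), Function.Surjective g ∧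
      (LinearMap.ker g.hom).FG ∧ φ ≫ hoSingleMap q g = 0 := by
  induction hF generalizing M with
  | zero Z hZ =>
    refine ⟨M, 𝟙 M, Function.surjective_id, ?_, hZ.eq_of_src _ _⟩
    change (LinearMap.ker LinearMap.id).FG
    rw [LinearMap.ker_id]
    exact Submodule.fg_bot
  | shift E hE ℓ h₁ h₂ =>
    obtain ⟨A, _, -, rfl⟩ := hE
    obtain ⟨M', g, hg, hg', h⟩ := exists_single_comp_eq_zero q ℓ A M ((hoSingleIso ℓ A).inv ≫ φ)
    refine ⟨M', g, hg, hg', ?_⟩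
    rwa [← cancel_epi (hoSingleIso ℓ A).inv, comp_zero, ← Category.assoc]
  | ext Tr hTr _ _ ih₁ ih₃ =>
    obtain ⟨M₁, g₁, hg₁, hg₁', h₁⟩ := ih₁ M (Tr.mor₁ ≫ φ)
    obtain ⟨χ, hχ⟩ : ∃ χ : Tr.obj₃ ⟶ hoSingle q M₁, φ ≫ hoSingleMap q g₁ = Tr.mor₂ ≫ χ :=
      Triangle.yoneda_exact₂ _ hTr _ (by rw [← Category.assoc, h₁])
    obtain ⟨M₂, g₂, hg₂, hg₂', h₂⟩ := ih₃ M₁ χ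
    refine ⟨M₂, g₁ ≫ g₂, hg₂.comp hg₁, ?_, ?_⟩
    · change (LinearMap.ker (g₂.hom ∘ₗ g₁.hom)).FG
      rw [LinearMap.ker_comp]
      refine Submodule.fg_of_fg_map_of_fg_inf_ker g₁.hom ?_ ?_
      · rwa [Submodule.map_comap_eq_of_surjective hg₁]
      · rwa [inf_eq_right.2 (LinearMap.ker_le_comap _)]
    · rw [hoSingleMap, Functor.map_comp, Functor.map_comp, ← Category.assoc, hχ,
        Category.assoc, h₂, comp_zero]

lemma isIso_homologyMap_mkHomToSingle (K : CochainComplex (ModuleCat.{u} R) ℤ) (p : ℤ)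
    (hK : IsZero (K.X (p + 1))) :
    IsIso (homologyMap (mkHomToSingle (K.pOpcycles p) (fun i _ ↦ K.d_pOpcycles i p)) p) := by
  have h : homologyMap (mkHomToSingle (K.pOpcycles p) (fun i _ ↦ K.d_pOpcycles i p)) p ≫
      (singleObjHomologySelfIso (ComplexShape.up ℤ) p (K.opcycles p)).hom = K.homologyι p := by
    rw [← cancel_epi (K.homologyπ p), homologyπ_naturality_assoc,
      homologyπ_singleObjHomologySelfIso_hom, singleObjCyclesSelfIso_hom, cyclesMap_i_assoc,
      mkHomToSingle_f, homology_π_ι]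
    simp
  have : IsIso (K.homologyι p) :=
    K.isIso_homologyι p (p + 1) (by simp) (hK.eq_of_tgt _ _)
  rw [← h] at this
  exact IsIso.of_isIso_comp_right _ (singleObjHomologySelfIso (ComplexShape.up ℤ) p _).hom

lemma exists_hom_hoSingle {c d p : ℤ} {F : HoMod R} (hF : SmnMem (finProj R) c d F)
    (hp : AcyclicFrom (p + 1) F) :
    ∃ (M : ModuleCat.{u} R) (χ : F ⟶ hoSingle p M), IsIso ((hoH R p).map χ) := by
  obtain ⟨K, rfl⟩ : ∃ K : CochainComplex (ModuleCat.{u} R) ℤ, (toHoMod R).obj K = F :=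
    HomotopyCategory.quotient_obj_surjective F
  have hK : K.IsLE p := (CochainComplex.isLE_iff K p).2 fun i hi ↦ by
    rw [exactAt_iff_isZero_homology, ← subsingleton_hoH_iff]
    exact hp i (by lia)
  have hι (i : ℤ) : IsIso (homologyMap (K.ιTruncLE p) i) := inferInstance
  have hι' (i : ℤ) : IsIso ((hoH R i).map ((toHoMod R).map (K.ιTruncLE p))) := by
    have := hι i
    have h := hoHIso_naturality (K.ιTruncLE p) i
    rw [← Iso.eq_comp_inv] at h
    rw [h]
    infer_instance
  obtain ⟨W, v, w, hT⟩ := distinguished_cocone_triangle ((toHoMod R).map (K.ιTruncLE p))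
  have hb (j : ℤ) : Function.Bijective ((hoH R j).map ((toHoMod R).map (K.ιTruncLE p))) :=
    ConcreteCategory.bijective_of_isIso _
  have hW : AcyclicFrom c W := acyclicFrom_of_bijective_surjective hT
    (fun j _ ↦ (hb j).1) (fun j _ ↦ (hb j).2)
  obtain ⟨s, hs⟩ : ∃ s : (toHoMod R).obj K ⟶ (toHoMod R).obj (K.truncLE p),
      𝟙 _ = s ≫ (toHoMod R).map (K.ιTruncLE p) := Triangle.coyoneda_exact₂ _ hT (𝟙 _)
    (hom_eq_zero_of_smnMem_finProj hF hW _)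
  let χ := mkHomToSingle ((K.truncLE p).pOpcycles p) (fun i _ ↦ (K.truncLE p).d_pOpcycles i p)
  have h₁ : IsIso ((hoH R p).map s) := by
    have h : (hoH R p).map s ≫ (hoH R p).map ((toHoMod R).map (K.ιTruncLE p)) = 𝟙 _ := by
      rw [← Functor.map_comp, ← hs, CategoryTheory.Functor.map_id]
    have := hι' p
    exact IsIso.of_isIso_fac_right h
  have h₂ : IsIso ((hoH R p).map ((toHoMod R).map χ)) := by
    have : IsIso (homologyMap χ p) := isIso_homologyMap_mkHomToSingle _ _
      (CochainComplex.isZero_of_isStrictlyLE _ p (p + 1) (by lia))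
    have h := hoHIso_naturality χ p
    rw [← Iso.eq_comp_inv] at h
    rw [h]
    infer_instance
  refine ⟨_, s ≫ (toHoMod R).map χ, ?_⟩
  rw [Functor.map_comp]
  infer_instance

lemma finite_hoH_of_smnMem_finProj {c d p : ℤ} {F : HoMod R} (hF : SmnMem (finProj R) c d F)
    (hp : AcyclicFrom (p + 1) F) : Module.Finite R ((hoH R p).obj F) := by
  obtain ⟨M, χ, hχ⟩ := exists_hom_hoSingle hF hp
  obtain ⟨M', g, hg, hg', h⟩ := exists_comp_hoSingleMap_eq_zero hF p M χ
  let e (A : ModuleCat.{u} R) : (hoH R p).obj (hoSingle p A) ≅ A :=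
    hoHIso _ p ≪≫ singleObjHomologySelfIso (ComplexShape.up ℤ) p A
  have he : (hoH R p).map (hoSingleMap p g) ≫ (e M').hom = (e M).hom ≫ g := by
    dsimp only [e, Iso.trans_hom]
    rw [← Category.assoc, hoHIso_naturality, Category.assoc,
      singleObjHomologySelfIso_hom_naturality, Category.assoc]
  have hg0 : g = 0 := by
    have h0 : (hoH R p).map (hoSingleMap p g) = 0 := by
      rw [← cancel_epi ((hoH R p).map χ), ← Functor.map_comp, h, Functor.map_zero, comp_zero]
    rw [← cancel_epi (e M).hom, ← he, h0, zero_comp, comp_zero]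
  have : Module.Finite R M := by
    rw [hg0] at hg'
    exact ⟨by rwa [ModuleCat.hom_zero, LinearMap.ker_zero] at hg'⟩
  exact Module.Finite.equiv (asIso ((hoH R p).map χ) ≪≫ e M).symm.toLinearEquiv

lemma PseudoCoherentFrom.finite_hoH {n p : ℤ} {E : HoMod R} (hE : PseudoCoherentFrom n E)
    (hn : n ≤ p) (hp : AcyclicFrom (p + 1) E) : Module.Finite R ((hoH R p).obj E) := by
  obtain ⟨D, g, b, ⟨F, i, h, hF, hT⟩, hD⟩ := hE
  have := finite_hoH_of_smnMem_finProj (p := p) hF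
    (AcyclicFrom.fiber hT hp (hD.mono hn))
  refine Module.Finite.of_surjective ((hoH R p).map i).hom fun x ↦ ?_
  exact (hoH_exact₂ hT p x).1 ((hD p hn).elim _ _)

end Finiteness

section Approximation

variable {R : Type u} [CommRing R]

lemma AcyclicFrom.of_hasFiberIn {L : List R} {p a : ℤ} {E C : HoMod R} {g : E ⟶ C}
    (hE : AcyclicFrom (p + 1) E) (hg : HasFiberIn (SmnMem {hoKoszul L} a p) g) :
    AcyclicFrom (p + 1) C := by
  obtain ⟨P, i, h, hP, hT⟩ := hg
  exact AcyclicFrom.cone hT ((acyclicFrom_of_smnMem hP).mono (by lia)) hE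

lemma surjective_hoH_map_of_hasFiberIn {L : List R} {p a : ℤ} {E C : HoMod R} {g : E ⟶ C}
    (hg : HasFiberIn (SmnMem {hoKoszul L} a p) g) : Function.Surjective ((hoH R p).map g) := by
  obtain ⟨P, i, h, hP, hT⟩ := hg
  exact fun x ↦ (hoH_exact₃ hT p _ rfl x).1
    ((acyclicFrom_of_smnMem hP (p + 1) le_rfl).elim _ _)

/-- A top cohomology group which is finitely generated and torsion is killed by an object built
from Koszul complexes. -/
lemma exists_subsingleton_hoH (L : List R) {n p : ℤ} (hp : n + L.length ≤ p) (s : ℕ) {E : HoMod R}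
    (hE : TorsionFrom L n E) (v : Fin s → (hoH R p).obj E)
    (hv : Submodule.span R (Set.range v) = ⊤) :
    ∃ (C : HoMod R) (g : E ⟶ C),
      HasFiberIn (SmnMem {hoKoszul L} p p) g ∧ Subsingleton ((hoH R p).obj C) := by
  induction s generalizing E with
  | zero =>
    refine ⟨E, 𝟙 E, HasFiberIn.id (fun _ ↦ .zero _) E, ?_⟩
    rw [Set.range_eq_empty, Submodule.span_empty] at hv
    exact (Submodule.subsingleton_iff R).1 (subsingleton_of_bot_eq_top hv)
  | succ s ih =>
    obtain ⟨C, g, hg, hx⟩ := exists_map_eq_zero L hp hE (v 0)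
    obtain ⟨C', g', hg', h⟩ := ih (hE.of_hasFiberIn hg) (fun i ↦ (hoH R p).map g (v i.succ)) (by
      rw [eq_top_iff]
      have h := congr_arg (Submodule.map ((hoH R p).map g).hom) hv
      rw [Submodule.map_top, LinearMap.range_eq_top.2 (surjective_hoH_map_of_hasFiberIn hg)] at h
      rw [← h, Submodule.map_span_le]
      rintro _ ⟨i, rfl⟩
      refine Fin.cases ?_ (fun i ↦ ?_) i
      · exact hx ▸ Submodule.zero_mem _
      · exact Submodule.subset_span ⟨i, rfl⟩)
    exact ⟨C', g ≫ g', hg.comp (fun Tr hTr ↦ .ext Tr hTr) hg', h⟩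

lemma exists_hasFiberIn_acyclicFrom (L : List R) {n m p₀ : ℤ} (hm : n + L.length ≤ m) (k : ℕ)
    (hk : m + k ≤ p₀ + 1) {E : HoMod R} (hE : TorsionFrom L n E) (hE' : PseudoCoherentFrom m E)
    (hE'' : AcyclicFrom (m + k) E) :
    ∃ (C : HoMod R) (g : E ⟶ C), HasFiberIn (SmnMem {hoKoszul L} m p₀) g ∧ AcyclicFrom m C := by
  induction k generalizing E with
  | zero =>
    exact ⟨E, 𝟙 E, HasFiberIn.id (fun _ ↦ .zero _) E, by simpa using hE''⟩
  | succ k ih =>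
    push_cast at hk hE''
    rw [← add_assoc] at hE''
    have := hE'.finite_hoH (by lia) hE''
    obtain ⟨s, v, hv⟩ := Module.Finite.exists_fin (R := R) (M := (hoH R (m + k)).obj E)
    obtain ⟨C, g, hg, hC⟩ := exists_subsingleton_hoH L (p := m + k) (by lia) s hE v hv
    obtain ⟨C', g', hg', hC'⟩ := ih (by lia) (hE.of_hasFiberIn hg) (hE'.of_hasFiberIn hg)
      (fun i hi ↦ by
        rcases hi.lt_or_eq with hi | rfl
        · exact hE''.of_hasFiberIn hg i (by lia)
        · exact hC)
    exact ⟨C', g ≫ g', (hg.mono fun P ↦ .mono (by lia) (by lia)).comp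
      (fun Tr hTr ↦ .ext Tr hTr) hg', hC'⟩

lemma bijective_hoH_map_of_acyclicFrom {n : ℤ} {Tr : Triangle (HoMod R)}
    (hTr : Tr ∈ distTriang (HoMod R)) (h : AcyclicFrom n Tr.obj₃) :
    (∀ j, n < j → Function.Bijective ((hoH R j).map Tr.mor₁)) ∧
      Function.Surjective ((hoH R n).map Tr.mor₁) := by
  have hs (j : ℤ) (hj : n ≤ j) : Function.Surjective ((hoH R j).map Tr.mor₁) :=
    fun x ↦ (hoH_exact₂ hTr j x).1 ((h j hj).elim _ _)
  refine ⟨fun j hj ↦ ⟨?_, hs j hj.le⟩, hs n le_rfl⟩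
  refine (injective_iff_map_eq_zero ((hoH R j).map Tr.mor₁).hom).2 fun x hx ↦ ?_
  obtain ⟨y, rfl⟩ := (hoH_exact₁ hTr (j - 1) j (by lia) x).1 hx
  rw [(h (j - 1) (by lia)).elim y 0, map_zero]

end Approximation

open CategoryTheory.Limits in
/-- **Corollary 5.8(i) of Lipman–Neeman.** Let `I = (f₁, …, f_r)R`, let `m ∈ ℤ`, and let
`E` be an `R`-complex with `H^i(E)` an `I`-torsion module for all `i ≥ m − r`.  If `E` is
`m`-pseudo-coherent (there is an `m`-quasi-isomorphism `Q₀ ⟶ E` with `Q₀` a bounded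
complex of finite-rank free `R`-modules) and `p ≥ m` satisfies `H^i(E) = 0` for all
`i > p`, then in the homotopy category `K(R)` there is an `m`-quasi-isomorphism `P ⟶ E`
with `P` an object of `{K_•(f₁, …, f_r)}[m, p]`. -/
theorem statement_16 (R : Type u) [CommRing R] (r : ℕ) (f : Fin r → R) (m : ℤ)
    (E : CochainComplex (ModuleCat.{u} R) ℤ)
    (hE : ∀ i : ℤ, m - (r : ℤ) ≤ i →
      IsIdealTorsion R (Ideal.span (Set.range f)) (E.homology i))
    (hpc : ∃ (Q₀ : CochainComplex (ModuleCat.{u} R) ℤ)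
      (_ : ∃ a b : ℤ, ∀ i : ℤ, (i < a ∨ b < i) → IsZero (Q₀.X i))
      (_ : ∀ i : ℤ, Module.Free R (Q₀.X i) ∧ Module.Finite R (Q₀.X i))
      (ξ₀ : Q₀ ⟶ E),
        (∀ j : ℤ, m < j → Function.Bijective (HomologicalComplex.homologyMap ξ₀ j)) ∧
          Function.Surjective (HomologicalComplex.homologyMap ξ₀ m))
    (p : ℤ) (hmp : m ≤ p) (hvan : ∀ i : ℤ, p < i → IsZero (E.homology i)) :
    ∃ P : HomotopyCategory (ModuleCat.{u} R) (ComplexShape.up ℤ),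
      SmnMem
        {(HomotopyCategory.quotient (ModuleCat.{u} R) (ComplexShape.up ℤ)).obj
          (koszul R (List.ofFn f))} m p P ∧
      ∃ ξ : P ⟶ (HomotopyCategory.quotient (ModuleCat.{u} R) (ComplexShape.up ℤ)).obj E,
        (∀ j : ℤ, m < j → Function.Bijective
          ((HomotopyCategory.homologyFunctor (ModuleCat.{u} R) (ComplexShape.up ℤ) j).map ξ)) ∧
        Function.Surjective
          ((HomotopyCategory.homologyFunctor (ModuleCat.{u} R) (ComplexShape.up ℤ) m).map ξ) := by
  have hT : TorsionFrom (List.ofFn f) (m - r) ((toHoMod R).obj E) := by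
    intro g hg i hi x
    obtain ⟨k, rfl⟩ := List.mem_ofFn.1 hg
    obtain ⟨N, hN⟩ := hE i hi ((hoHIso E i).hom x)
    refine ⟨N, (hoHIso E i).toLinearEquiv.injective ?_⟩
    rw [map_smul, map_zero]
    exact hN _ (Ideal.pow_mem_pow (Ideal.subset_span (Set.mem_range_self k)) N)
  obtain ⟨Q, ⟨a, b, hQ⟩, hQ', ξ, h₁, h₂⟩ := hpc
  have hPC : PseudoCoherentFrom m ((toHoMod R).obj E) :=
    pseudoCoherentFrom_of_map hQ (fun i ↦ by
      obtain ⟨_, _⟩ := hQ' i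
      exact ⟨inferInstance, inferInstance⟩) ξ h₁ h₂
  obtain ⟨C, g, ⟨P, ξ, h, hP, hTr⟩, hC⟩ := exists_hasFiberIn_acyclicFrom (List.ofFn f)
    (n := m - r) (m := m) (p₀ := p) (by rw [List.length_ofFn]; lia) (p + 1 - m).toNat (by lia)
    hT hPC (fun i hi ↦ (subsingleton_hoH_iff E i).2 (hvan i (by lia)))
  exact ⟨P, hP, ξ, bijective_hoH_map_of_acyclicFrom hTr hC⟩
end

section
/- Let A be a commutative ring and a an integer. Call an object of D(A) a-projective if it is D(A)-isomorphic to a bounded complex of projective A-modules vanishing in all degrees < a. Given a distinguished triangle N[−1] → L → M → N in D(A) with N a-projective, M is a-projective if and only if L is a-projective. -/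
open CategoryTheory CategoryTheory.Limits CategoryTheory.Pretriangulated DerivedCategory

universe u

/-- An object of `D(A)` is *`a`-projective* if it is `D(A)`-isomorphic to a bounded
complex of projective `A`-modules vanishing in all degrees `< a`. -/
def IsAProjective (A : Type u) [CommRing A] [HasDerivedCategory.{u + 1} (ModuleCat.{u} A)]
    (a : ℤ) (E : DerivedCategory (ModuleCat.{u} A)) : Prop :=
  ∃ P : CochainComplex (ModuleCat.{u} A) ℤ,
    (∀ i : ℤ, Module.Projective A (P.X i)) ∧
    (∃ b : ℤ, ∀ i : ℤ, (i < a ∨ b < i) → IsZero (P.X i)) ∧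
    Nonempty (E ≅ Q.obj P)

lemma CochainComplex.IsKProjective.Q_map_surjective {C : Type*} [Category* C] [Abelian C]
    [HasDerivedCategory C] (K L : CochainComplex C ℤ) [K.IsKProjective] :
    Function.Surjective (Q.map : (K ⟶ L) → (Q.obj K ⟶ Q.obj L)) := by
  intro f
  obtain ⟨g, hg⟩ := (Qh_map_bijective K ((HomotopyCategory.quotient _ _).obj L)).surjective
    ((quotientCompQhIso C).hom.app K ≫ f ≫ (quotientCompQhIso C).inv.app L)
  obtain ⟨g, rfl⟩ := (HomotopyCategory.quotient _ _).map_surjective g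
  refine ⟨g, ?_⟩
  rw [← cancel_epi ((quotientCompQhIso C).hom.app K), ← quotientCompQhIso_hom_naturality, hg]
  simp

lemma CochainComplex.mappingCone.projective_X {A : Type u} [CommRing A]
    {K L : CochainComplex (ModuleCat.{u} A) ℤ}
    (f : K ⟶ L) (hK : ∀ i, Module.Projective A (K.X i))
    (hL : ∀ i, Module.Projective A (L.X i)) (i : ℤ) :
    Module.Projective A ((mappingCone f).X i) := by
  have : Projective (K.X (i + 1) ⊞ L.X i) := inferInstance
  have : Projective ((mappingCone f).X i) :=
    Projective.of_iso (HomologicalComplex.homotopyCofiber.XIsoBiprod f i (i + 1) rfl).symm this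
  exact ModuleCat.projective_of_module_projective _

section

variable {A : Type u} [CommRing A] [HasDerivedCategory.{u + 1} (ModuleCat.{u} A)]

lemma IsAProjective.of_iso {a : ℤ} {E F : DerivedCategory (ModuleCat.{u} A)}
    (hF : IsAProjective A a F) (e : E ≅ F) : IsAProjective A a E := by
  obtain ⟨P, hP, hb, ⟨e'⟩⟩ := hF
  exact ⟨P, hP, hb, ⟨e ≪≫ e'⟩⟩

lemma IsAProjective.mono {a a' : ℤ} {E : DerivedCategory (ModuleCat.{u} A)}
    (hE : IsAProjective A a E) (h : a' ≤ a) : IsAProjective A a' E := by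
  obtain ⟨P, hP, ⟨b, hb⟩, e⟩ := hE
  exact ⟨P, hP, ⟨b, fun i hi ↦ hb i (by lia)⟩, e⟩

lemma IsAProjective.shift {a : ℤ} {E : DerivedCategory (ModuleCat.{u} A)}
    (hE : IsAProjective A a E) (n : ℤ) : IsAProjective A (a - n) (E⟦n⟧) := by
  obtain ⟨P, hP, ⟨b, hb⟩, ⟨e⟩⟩ := hE
  exact ⟨P⟦n⟧, fun i ↦ hP (i + n), ⟨b - n, fun i hi ↦ hb (i + n) (by lia)⟩,
    ⟨(shiftFunctor _ n).mapIso e ≪≫ (Q.commShiftIso n).symm.app P⟩⟩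

/-- The cone of a morphism from an `(a + 1)`-projective object to an `a`-projective object
is `a`-projective. -/
lemma IsAProjective.of_distTriang {a : ℤ} (T : Triangle (DerivedCategory (ModuleCat.{u} A)))
    (hT : T ∈ distTriang _) (h₁ : IsAProjective A (a + 1) T.obj₁)
    (h₂ : IsAProjective A a T.obj₂) : IsAProjective A a T.obj₃ := by
  obtain ⟨K, hK, ⟨b, hb⟩, ⟨e₁⟩⟩ := h₁
  obtain ⟨L, hL, ⟨c, hc⟩, ⟨e₂⟩⟩ := h₂
  have : K.IsStrictlyLE b :=
    (CochainComplex.isStrictlyLE_iff K b).2 fun i hi ↦ hb i (Or.inr hi)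
  have : K.IsKProjective := CochainComplex.isKProjective_of_projective K b
  obtain ⟨f, hf⟩ :=
    CochainComplex.IsKProjective.Q_map_surjective K L (e₁.inv ≫ T.mor₁ ≫ e₂.hom)
  have comm : T.mor₁ ≫ e₂.hom = e₁.hom ≫ Q.map f := by simp [hf]
  refine ⟨CochainComplex.mappingCone f, CochainComplex.mappingCone.projective_X f hK hL,
    ⟨max b c, fun i hi ↦ ?_⟩, ⟨?_⟩⟩
  · rw [CochainComplex.mappingCone.isZero_X_iff]
    exact ⟨hb _ (by lia), hc _ (by lia)⟩
  · exact Triangle.π₃.mapIso (isoTriangleOfIso₁₂ T _ hT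
      (mappingCone_triangle_distinguished f) e₁ e₂ comm)

end

/-- **Lipman–Neeman, observation (∗) in the proof of Lemma 3.3.** Given a distinguished
triangle `N[−1] → L → M → N` in `D(A)` with `N` an `a`-projective object, `M` is
`a`-projective if and only if `L` is. -/
theorem statement_19 (A : Type u) [CommRing A]
    [HasDerivedCategory.{u + 1} (ModuleCat.{u} A)]
    (a : ℤ) (L M N : DerivedCategory (ModuleCat.{u} A))
    (δ : N⟦(-1 : ℤ)⟧ ⟶ L) (φ : L ⟶ M) (ρ : M ⟶ N)
    (hT : Triangle.mk δ φ
        (ρ ≫ (shiftFunctorCompIsoId (DerivedCategory (ModuleCat.{u} A)) (-1 : ℤ) (1 : ℤ)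
          (by norm_num)).inv.app N) ∈
      distTriang (DerivedCategory (ModuleCat.{u} A)))
    (hN : IsAProjective A a N) :
    (IsAProjective A a M ↔ IsAProjective A a L) := by
  constructor
  · intro hM
    have hN' : IsAProjective A (a - 1) ((N⟦(-1 : ℤ)⟧)⟦(1 : ℤ)⟧) :=
      ((hN.shift (-1)).shift 1).mono (by lia)
    have hL : IsAProjective A (a - 1) (L⟦(1 : ℤ)⟧) :=
      IsAProjective.of_distTriang _ (rot_of_distTriang _ (rot_of_distTriang _ hT))
        (by simpa using hM) hN'
    exact ((hL.shift (-1)).mono (by lia)).of_iso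
      ((shiftFunctorCompIsoId _ (1 : ℤ) (-1) (by norm_num)).app L).symm
  · intro hL
    exact IsAProjective.of_distTriang _ hT ((hN.shift (-1)).mono (by lia)) hL
end
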